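/- arXiv:math/0601526 — 3 statements merged into one kernel-verified Lean document; each statement's English description precedes it below -/
import Mathlib

section
/- Assume that for each fixed (x,t) the map z ↦ φ(x,t,z) takes at most finitely many values, and let (x,t) ∈ (0,∞)ⁿ × [0,T]. Then the following three conditions are equivalent: (i) B is LCP at (x,t); (ii) for all directions v ∈ ℝⁿ \ {0} and all convex f ∈ F with ∂_v²f(x) = 0, ∫₀¹ ( f_vv(x+φ) + 2 φ_v·∇f_v(x+φ) + φ_vᵀ Hf(x+φ) φ_v + φ_vv·(∇f(x+φ) − ∇f(x)) ) dz ≥ 0; (iii) for all directions v ∈ ℝⁿ \ {0} and all convex f ∈ F, ∫₀¹ φ_vv·( ∇f(x + φ) − ∇f(x) ) dz ≥ 0. Here φ = φ(x,t,z), and φ_v, φ_vv denote the first and second directional x-derivatives of φ in direction v. -/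
open MeasureTheory Set Matrix NNReal

noncomputable section

/-- The open positive orthant `(0,∞)ⁿ` in `ℝⁿ`. -/
def posOrth (n : ℕ) : Set (Fin n → ℝ) := {x | ∀ i, 0 < x i}

/-- First directional derivative of `f` at `x` in direction `v`. -/
def dir1 {n : ℕ} {F : Type*} [NormedAddCommGroup F] [NormedSpace ℝ F]
    (f : (Fin n → ℝ) → F) (x v : Fin n → ℝ) : F :=
  fderiv ℝ f x v

/-- Mixed second derivative: differentiate `f` in direction `v`, then in direction `w`. -/
def dmix {n : ℕ} {F : Type*} [NormedAddCommGroup F] [NormedSpace ℝ F]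
    (f : (Fin n → ℝ) → F) (x v w : Fin n → ℝ) : F :=
  fderiv ℝ (fun y => fderiv ℝ f y v) x w

/-- Second directional derivative of `f` at `x` in direction `v`. -/
def dir2 {n : ℕ} {F : Type*} [NormedAddCommGroup F] [NormedSpace ℝ F]
    (f : (Fin n → ℝ) → F) (x v : Fin n → ℝ) : F :=
  dmix f x v v

/-- The class `F` of test functions: `C⁴` on the positive orthant, with locally Hölder
continuous fourth derivatives, and with `f` together with its derivatives up to order two
of at most polynomial growth. -/
structure MemTestClass (n : ℕ) (f : (Fin n → ℝ) → ℝ) : Prop where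
  smooth : ContDiffOn ℝ 4 f (posOrth n)
  holder4 : ∃ α : ℝ≥0, 0 < α ∧ (α : ℝ) ≤ 1 ∧
    ∀ x ∈ posOrth n, ∃ s ∈ nhds x, s ⊆ posOrth n ∧
      ∃ C : ℝ≥0, HolderOnWith C α (iteratedFDeriv ℝ 4 f) s
  polyGrowth : ∃ C m : ℝ, ∀ x ∈ posOrth n, ∀ k : ℕ, k ≤ 2 →
    ‖iteratedFDeriv ℝ k f x‖ ≤ C * (1 + ‖x‖ ^ m)

/-- The jump structure `φ(x,t,z)` together with the standing assumptions (A3), (A6), (A7). -/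
structure JumpKernel (n : ℕ) (T : ℝ) where
  φ : (Fin n → ℝ) → ℝ → ℝ → (Fin n → ℝ)
  meas : ∀ x ∈ posOrth n, ∀ t ∈ Icc (0:ℝ) T, Measurable (fun z => φ x t z)
  smooth : ∀ t ∈ Icc (0:ℝ) T, ∀ z ∈ Icc (0:ℝ) 1,
    ContDiffOn ℝ 2 (fun x => φ x t z) (posOrth n)
  holder2 : ∃ α : ℝ≥0, 0 < α ∧ (α : ℝ) ≤ 1 ∧
    ∀ t ∈ Icc (0:ℝ) T, ∀ x ∈ posOrth n, ∃ s ∈ nhds x, s ⊆ posOrth n ∧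
      ∃ C : ℝ≥0, ∀ z ∈ Icc (0:ℝ) 1,
        HolderOnWith C α (iteratedFDeriv ℝ 2 (fun y => φ y t z)) s
  bound : ∃ D : ℝ, 0 < D ∧ ∀ x ∈ posOrth n, ∀ t ∈ Icc (0:ℝ) T, ∀ z ∈ Icc (0:ℝ) 1,
    ∀ i, (φ x t z i) ^ 2 ≤ D * (x i) ^ 2
  lower : ∃ γ₀ : ℝ, -1 < γ₀ ∧ ∀ x ∈ posOrth n, ∀ t ∈ Icc (0:ℝ) T, ∀ z ∈ Icc (0:ℝ) 1,
    ∀ i, γ₀ * x i < φ x t z i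

/-- For each fixed `(x,t)`, `φ(x,t,z) ≠ 0` for almost every `z ∈ [0,1]`. -/
def JumpKernel.AENonzero {n : ℕ} {T : ℝ} (K : JumpKernel n T) : Prop :=
  ∀ x ∈ posOrth n, ∀ t ∈ Icc (0:ℝ) T,
    ∀ᵐ z ∂(volume.restrict (Icc (0:ℝ) 1)), K.φ x t z ≠ 0

/-- The jump intensity `λ` : nonnegative and Hölder continuous on `[0,T]`. -/
def LamOK (T : ℝ) (lam : ℝ → ℝ) : Prop :=
  (∀ t ∈ Icc (0:ℝ) T, 0 ≤ lam t) ∧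
  ∃ α C : ℝ≥0, 0 < α ∧ (α : ℝ) ≤ 1 ∧ HolderOnWith C α lam (Icc (0:ℝ) T)

/-- The integro-differential jump operator `B`. -/
def Bop {n : ℕ} {T : ℝ} (lam : ℝ → ℝ) (K : JumpKernel n T)
    (f : (Fin n → ℝ) → ℝ) (x : Fin n → ℝ) (t : ℝ) : ℝ :=
  lam t * ∫ z in Icc (0:ℝ) 1,
    (f (x + K.φ x t z) - f x - fderiv ℝ f x (K.φ x t z))

/-- The diffusion matrix `β(x,t)` together with the standing assumptions (A1), (A3), (A5). -/
structure DiffKernel (n : ℕ) (T : ℝ) where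
  β : (Fin n → ℝ) → ℝ → Matrix (Fin n) (Fin n) ℝ
  smooth : ∀ t ∈ Icc (0:ℝ) T, ∀ i j, ContDiffOn ℝ 2 (fun x => β x t i j) (posOrth n)
  holder2 : ∃ α : ℝ≥0, 0 < α ∧ (α : ℝ) ≤ 1 ∧
    ∀ t ∈ Icc (0:ℝ) T, ∀ i j, ∀ x ∈ posOrth n, ∃ s ∈ nhds x, s ⊆ posOrth n ∧
      ∃ C : ℝ≥0, HolderOnWith C α (iteratedFDeriv ℝ 2 (fun y => β y t i j)) s
  nonsing : ∀ x ∈ posOrth n, ∀ t ∈ Icc (0:ℝ) T, (β x t).det ≠ 0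
  bound : ∃ D : ℝ, 0 < D ∧ ∀ x ∈ posOrth n, ∀ t ∈ Icc (0:ℝ) T,
    ∀ i, ∑ j, (β x t i j) ^ 2 ≤ D * (x i) ^ 2

/-- The second order differential operator `A` with coefficient matrix `a = ββ*/2`. -/
def Aop {n : ℕ} {T : ℝ} (Dk : DiffKernel n T)
    (f : (Fin n → ℝ) → ℝ) (x : Fin n → ℝ) (t : ℝ) : ℝ :=
  ∑ i, ∑ j, ((Dk.β x t * (Dk.β x t)ᵀ) i j / 2) *
    dmix f x (Pi.single i 1) (Pi.single j 1)

/-- An operator `D` (mapping a test function `f` to a function of `(x,t)`) is locally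
convexity preserving (LCP) at `(x,t)` if `∂_v²(Df)(x,t) ≥ 0` for every direction `v ≠ 0`
and every convex `f ∈ F` with `∂_v²f(x) = 0`. -/
def IsLCPAt {n : ℕ} (D : ((Fin n → ℝ) → ℝ) → (Fin n → ℝ) → ℝ → ℝ)
    (x : Fin n → ℝ) (t : ℝ) : Prop :=
  ∀ v : Fin n → ℝ, v ≠ 0 → ∀ f : (Fin n → ℝ) → ℝ,
    MemTestClass n f → ConvexOn ℝ (posOrth n) f → dir2 f x v = 0 →
    0 ≤ dir2 (fun y => D f y t) x v

/-- The integrand in condition (ohly) of Theorem 5.1. -/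
def ohlyIntegrand {n : ℕ} {T : ℝ} (K : JumpKernel n T)
    (f : (Fin n → ℝ) → ℝ) (x v : Fin n → ℝ) (t z : ℝ) : ℝ :=
  dmix f (x + K.φ x t z) v v
    + 2 * dmix f (x + K.φ x t z) v (dir1 (fun y => K.φ y t z) x v)
    + dmix f (x + K.φ x t z) (dir1 (fun y => K.φ y t z) x v)
        (dir1 (fun y => K.φ y t z) x v)
    + (fderiv ℝ f (x + K.φ x t z) (dir2 (fun y => K.φ y t z) x v)
        - fderiv ℝ f x (dir2 (fun y => K.φ y t z) x v))


open Filter Topology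

section ConvexCalculus

variable {E : Type*} [NormedAddCommGroup E] [NormedSpace ℝ E]

theorem HasFDerivAt.tendsto_slope_right {F : Type*} [NormedAddCommGroup F] [NormedSpace ℝ F]
    {f : E → F} {L : E →L[ℝ] F} {p : E} (h : HasFDerivAt f L p) (v : E) :
    Tendsto (fun s : ℝ => s⁻¹ • (f (p + s • v) - f p)) (𝓝[>] 0) (𝓝 (L v)) :=
  (h.hasLineDerivAt v).tendsto_slope_zero_right

/-- A convex function lies above its tangent planes. -/
theorem ConvexOn.tangent_le {s : Set E} {f : E → ℝ} (hf : ConvexOn ℝ s f) {p y : E}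
    (hp : p ∈ s) (hy : y ∈ s) {L : E →L[ℝ] ℝ} (hL : HasFDerivAt f L p) :
    f p + L (y - p) ≤ f y := by
  suffices L (y - p) ≤ f y - f p by linarith
  refine le_of_tendsto (hL.tendsto_slope_right (y - p)) ?_
  filter_upwards [Ioo_mem_nhdsGT (zero_lt_one' ℝ)] with r hr
  have h := hf.2 hp hy (sub_nonneg.2 hr.2.le) hr.1.le (by ring)
  have e : (1 - r) • p + r • y = p + r • (y - p) := by module
  rw [e] at h
  simp only [smul_eq_mul] at h ⊢
  rw [inv_mul_le_iff₀ hr.1]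
  linarith

/-- The second derivative of a convex function is positive semidefinite. -/
theorem ConvexOn.fderiv_fderiv_nonneg {s : Set E} (hs : IsOpen s) {f : E → ℝ}
    (hf : ConvexOn ℝ s f) (hd : ContDiffOn ℝ 2 f s) {p : E} (hp : p ∈ s) (w : E) :
    0 ≤ fderiv ℝ (fderiv ℝ f) p w w := by
  have hd1 : ∀ y ∈ s, HasFDerivAt f (fderiv ℝ f y) y := fun y hy =>
    ((hd.contDiffAt (hs.mem_nhds hy)).differentiableAt (by norm_num)).hasFDerivAt
  have hd2 : HasFDerivAt (fderiv ℝ f) (fderiv ℝ (fderiv ℝ f) p) p :=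
    (((hd.fderiv_of_isOpen hs (m := 1) (by norm_num)).contDiffAt
      (hs.mem_nhds hp)).differentiableAt (by norm_num)).hasFDerivAt
  have ht := (ContinuousLinearMap.apply ℝ ℝ w).continuous.tendsto _ |>.comp
    (hd2.tendsto_slope_right w)
  refine ge_of_tendsto ht ?_
  have hcont : Tendsto (fun r : ℝ => p + r • w) (𝓝[>] 0) (𝓝 p) := by
    have : Continuous (fun r : ℝ => p + r • w) := by fun_prop
    simpa using (this.tendsto 0).mono_left nhdsWithin_le_nhds
  filter_upwards [hcont (hs.mem_nhds hp), self_mem_nhdsWithin] with r hr hr0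
  have h1 := hf.tangent_le hp hr (hd1 p hp)
  have h2 := hf.tangent_le hr hp (hd1 _ hr)
  have e1 : p + r • w - p = r • w := by abel
  have e2 : p - (p + r • w) = -(r • w) := by abel
  rw [e1] at h1
  rw [e2] at h2
  simp only [map_neg, map_smul, smul_eq_mul] at h1 h2
  have hr0' : (0 : ℝ) < r := hr0
  simp only [Function.comp_apply, map_smul, ContinuousLinearMap.apply_apply,
    _root_.sub_apply, smul_eq_mul]
  refine mul_nonneg (inv_nonneg.2 hr0'.le) ?_
  refine nonneg_of_mul_nonneg_right (?_ : 0 ≤ r * _) hr0'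
  linarith

/-- A null direction of a positive semidefinite symmetric bilinear form lies in its kernel. -/
theorem ContinuousLinearMap.apply_eq_zero_of_psd {B : E →L[ℝ] E →L[ℝ] ℝ}
    (hsymm : ∀ a b, B a b = B b a) (hpsd : ∀ a, 0 ≤ B a a) {v : E} (hv : B v v = 0) (w : E) :
    B v w = 0 := by
  by_contra hne
  have hc : 2 * B v w * (-(B w w + 1) / (2 * B v w)) = -(B w w + 1) := by field_simp
  have h := hpsd (w + (-(B w w + 1) / (2 * B v w)) • v)
  simp only [map_add, map_smul, _root_.add_apply, _root_.smul_apply,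
    smul_eq_mul, hv, hsymm w v] at h
  linarith

/-- If the second derivative of a convex function vanishes at `x` in direction `v`, then so do
the third derivatives at `x` involving `v` twice. -/
theorem ConvexOn.third_deriv_eq_zero {s : Set E} (hs : IsOpen s) {f : E → ℝ}
    (hf : ConvexOn ℝ s f) (hd : ContDiffOn ℝ 3 f s) {x : E} (hx : x ∈ s) {v : E}
    (hv : fderiv ℝ (fderiv ℝ f) x v v = 0) (w : E) :
    fderiv ℝ (fderiv ℝ (fderiv ℝ f)) x v v w = 0 := by
  have hd1 : ContDiffOn ℝ 2 (fderiv ℝ f) s := hd.fderiv_of_isOpen hs (by norm_num)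
  have hd2 : ContDiffOn ℝ 1 (fderiv ℝ (fderiv ℝ f)) s := hd1.fderiv_of_isOpen hs (by norm_num)
  have h3 : HasFDerivAt (fderiv ℝ (fderiv ℝ f)) (fderiv ℝ (fderiv ℝ (fderiv ℝ f)) x) x :=
    ((hd2.contDiffAt (hs.mem_nhds hx)).differentiableAt (by norm_num)).hasFDerivAt
  have h3app : ∀ a b : E, HasFDerivAt (fun y => fderiv ℝ (fderiv ℝ f) y a b)
      (((ContinuousLinearMap.apply ℝ ℝ b).comp (ContinuousLinearMap.apply ℝ (E →L[ℝ] ℝ) a)).comp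
        (fderiv ℝ (fderiv ℝ (fderiv ℝ f)) x)) x := fun a b =>
    HasFDerivAt.comp (g := (ContinuousLinearMap.apply ℝ ℝ b).comp
      (ContinuousLinearMap.apply ℝ (E →L[ℝ] ℝ) a)) x (ContinuousLinearMap.hasFDerivAt _) h3
  have hswap : fderiv ℝ (fderiv ℝ (fderiv ℝ f)) x v v w
      = fderiv ℝ (fderiv ℝ (fderiv ℝ f)) x v w v := by
    have heq : (fun y => fderiv ℝ (fderiv ℝ f) y v w) =ᶠ[𝓝 x]
        fun y => fderiv ℝ (fderiv ℝ f) y w v := by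
      filter_upwards [hs.mem_nhds hx] with y hy
      exact (hd.contDiffAt (hs.mem_nhds hy)).isSymmSndFDerivAt (by simp; norm_num) v w
    have := (h3app v w).unique ((h3app w v).congr_of_eventuallyEq heq)
    simpa using congrArg (fun L => L v) this
  have hsymm : fderiv ℝ (fderiv ℝ (fderiv ℝ f)) x v w = fderiv ℝ (fderiv ℝ (fderiv ℝ f)) x w v :=
    (hd1.contDiffAt (hs.mem_nhds hx)).isSymmSndFDerivAt (by simp) v w
  have hmin : IsLocalMin (fun y => fderiv ℝ (fderiv ℝ f) y v v) x := by
    filter_upwards [hs.mem_nhds hx] with y hy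
    rw [hv]
    exact hf.fderiv_fderiv_nonneg hs (hd.of_le (by norm_num)) hy v
  have := congrArg (fun L => L w) (hmin.hasFDerivAt_eq_zero (h3app v v))
  rw [hswap, hsymm]
  simpa using this

end ConvexCalculus

section ParametricIntegral

variable {n : ℕ}

theorem aestronglyMeasurable_of_hasFDerivAt {Z : Type*} [MeasurableSpace Z] {μ : Measure Z}
    {G : (Fin n → ℝ) → Z → ℝ} {G' : Z → (Fin n → ℝ) →L[ℝ] ℝ} {x : Fin n → ℝ}
    (hmeas : ∀ᶠ y in 𝓝 x, AEStronglyMeasurable (G y) μ)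
    (hd : ∀ᵐ z ∂μ, HasFDerivAt (G · z) (G' z) x) : AEStronglyMeasurable G' μ := by
  have happ : ∀ v, AEStronglyMeasurable (fun z => G' z v) μ := by
    intro v
    obtain ⟨ε, hε, hball⟩ := Metric.eventually_nhds_iff_ball.1 hmeas
    have hc : Tendsto (fun r : ℝ => x + r • v) (𝓝[>] 0) (𝓝 x) := by
      have : Continuous (fun r : ℝ => x + r • v) := by fun_prop
      simpa using (this.tendsto 0).mono_left nhdsWithin_le_nhds
    classical
    refine aestronglyMeasurable_of_tendsto_ae (𝓝[>] (0 : ℝ))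
      (f := fun r z => if x + r • v ∈ Metric.ball x ε then r⁻¹ • (G (x + r • v) z - G x z) else 0)
      (fun r => ?_) ?_
    · split_ifs with h
      · exact ((hball _ h).sub (hball x (Metric.mem_ball_self hε))).const_smul r⁻¹
      · exact aestronglyMeasurable_const
    · filter_upwards [hd] with z hz
      refine (hz.tendsto_slope_right v).congr' ?_
      filter_upwards [hc (Metric.ball_mem_nhds x hε)] with r hr
      exact (if_pos hr).symm
  have hrep : G' = fun z => ∑ i, G' z (Pi.single i 1) •
      (ContinuousLinearMap.proj i : (Fin n → ℝ) →L[ℝ] ℝ) := by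
    ext z v
    conv_lhs => rw [pi_eq_sum_univ' v]
    simp [mul_comm]
  rw [hrep]
  refine Finset.aestronglyMeasurable_fun_sum _ fun i _ => ?_
  exact (happ _).smul_const _

/-- Differentiation under the integral sign for uniformly bounded integrands. -/
theorem hasFDerivAt_integral_of_bounded {Z : Type*} [MeasurableSpace Z] {μ : Measure Z}
    [IsFiniteMeasure μ] {G : (Fin n → ℝ) → Z → ℝ}
    {G' : (Fin n → ℝ) → Z → (Fin n → ℝ) →L[ℝ] ℝ} {U : Set (Fin n → ℝ)} (hU : IsOpen U) {C C' : ℝ}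
    (hmeas : ∀ y ∈ U, AEStronglyMeasurable (G y) μ)
    (hd : ∀ᵐ z ∂μ, ∀ y ∈ U, HasFDerivAt (G · z) (G' y z) y)
    (hb : ∀ᵐ z ∂μ, ∀ y ∈ U, ‖G y z‖ ≤ C) (hb' : ∀ᵐ z ∂μ, ∀ y ∈ U, ‖G' y z‖ ≤ C')
    {x : Fin n → ℝ} (hx : x ∈ U) :
    Integrable (G' x) μ ∧ HasFDerivAt (fun y => ∫ z, G y z ∂μ) (∫ z, G' x z ∂μ) x := by
  have hm : ∀ᶠ y in 𝓝 x, AEStronglyMeasurable (G y) μ := by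
    filter_upwards [hU.mem_nhds hx] with y hy using hmeas y hy
  have hm' : AEStronglyMeasurable (G' x) μ :=
    aestronglyMeasurable_of_hasFDerivAt hm (hd.mono fun z hz => hz x hx)
  refine ⟨Integrable.of_bound hm' C' (hb'.mono fun z hz => hz x hx), ?_⟩
  exact hasFDerivAt_integral_of_dominated_of_fderiv_le (hU.mem_nhds hx) hm
    (Integrable.of_bound (hmeas x hx) C (hb.mono fun z hz => hz x hx)) hm' hb'
    (integrable_const C') hd

/-- The second directional derivative may be taken under the integral sign when the integrand
and its first two derivatives are uniformly bounded. -/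
theorem dir2_integral_of_bounded {Z : Type*} [MeasurableSpace Z] {μ : Measure Z}
    [IsFiniteMeasure μ] {G : (Fin n → ℝ) → Z → ℝ}
    {G' G'' : (Fin n → ℝ) → Z → (Fin n → ℝ) →L[ℝ] ℝ} {v : Fin n → ℝ}
    {U : Set (Fin n → ℝ)} (hU : IsOpen U) {C C' C'' : ℝ}
    (hmeas : ∀ y ∈ U, AEStronglyMeasurable (G y) μ)
    (hd : ∀ᵐ z ∂μ, ∀ y ∈ U, HasFDerivAt (G · z) (G' y z) y)
    (hd' : ∀ᵐ z ∂μ, ∀ y ∈ U, HasFDerivAt (fun y => G' y z v) (G'' y z) y)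
    (hb : ∀ᵐ z ∂μ, ∀ y ∈ U, ‖G y z‖ ≤ C) (hb' : ∀ᵐ z ∂μ, ∀ y ∈ U, ‖G' y z‖ ≤ C')
    (hb'' : ∀ᵐ z ∂μ, ∀ y ∈ U, ‖G'' y z‖ ≤ C'')
    {x : Fin n → ℝ} (hx : x ∈ U) :
    Integrable (fun z => G'' x z v) μ ∧
      dir2 (fun y => ∫ z, G y z ∂μ) x v = ∫ z, G'' x z v ∂μ := by
  have h1 := fun y (hy : y ∈ U) => hasFDerivAt_integral_of_bounded hU hmeas hd hb hb' hy
  obtain ⟨hi, h2⟩ := hasFDerivAt_integral_of_bounded (G := fun y z => G' y z v) (G' := G'')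
    (C := C' * ‖v‖) hU
    (fun y hy => ((h1 y hy).1.apply_continuousLinearMap v).aestronglyMeasurable) hd'
    (hb'.mono fun z hz y hy => (G' y z).le_of_opNorm_le (hz y hy) v) hb'' hx
  refine ⟨hi.apply_continuousLinearMap v, ?_⟩
  have heq : (fun y => fderiv ℝ (fun y => ∫ z, G y z ∂μ) y v) =ᶠ[𝓝 x]
      fun y => ∫ z, G' y z v ∂μ := by
    filter_upwards [hU.mem_nhds hx] with y hy
    rw [(h1 y hy).2.fderiv, ContinuousLinearMap.integral_apply (h1 y hy).1]
  rw [dir2, dmix, heq.fderiv_eq, h2.fderiv, ContinuousLinearMap.integral_apply hi]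

end ParametricIntegral

section Mollification

open scoped Convolution ContDiff

theorem lipschitzWith_convolution {E V W : Type*} [NormedAddCommGroup E] [NormedSpace ℝ E]
    [FiniteDimensional ℝ E] [MeasurableSpace E] [BorelSpace E] {μ : Measure E}
    [μ.IsAddHaarMeasure] [NormedAddCommGroup V] [NormedSpace ℝ V] [NormedAddCommGroup W]
    [NormedSpace ℝ W] (L : V →L[ℝ] ℝ →L[ℝ] W) {h : E → V}
    (hc : Continuous h) (hs : HasCompactSupport h) {F : E → ℝ} {K : ℝ≥0} (hF : LipschitzWith K F) :
    ∃ K' : ℝ≥0, LipschitzWith K' (h ⋆[L, μ] F) := by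
  have hex := hs.convolutionExists_left L hc (hF.continuous.locallyIntegrable (μ := μ))
  have hint : Integrable h μ := hc.integrable_of_hasCompactSupport hs
  refine ⟨(‖L‖ * (∫ u, ‖h u‖ ∂μ) * K).toNNReal, LipschitzWith.of_dist_le' fun y y' => ?_⟩
  rw [dist_eq_norm, convolution_def, convolution_def,
    ← integral_sub (hex y).integrable (hex y').integrable]
  refine (norm_integral_le_of_norm_le
    (hint.norm.const_mul (‖L‖ * (K * dist y y'))) (ae_of_all _ fun u => ?_)).trans_eq ?_
  · rw [← map_sub]
    refine (L.le_opNorm₂ _ _).trans ?_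
    have : ‖F (y - u) - F (y' - u)‖ ≤ K * dist y y' := by
      simpa [dist_eq_norm] using hF.dist_le_mul (y - u) (y' - u)
    calc ‖L‖ * ‖h u‖ * ‖F (y - u) - F (y' - u)‖ ≤ ‖L‖ * ‖h u‖ * (K * dist y y') := by gcongr
      _ = _ := by ring
  · rw [integral_const_mul]
    ring

variable {n : ℕ}

theorem isOpen_posOrth (n : ℕ) : IsOpen (posOrth n) := by
  simp only [posOrth, ofPred_forall]
  exact isOpen_iInter_of_finite fun i => isOpen_lt continuous_const (continuous_apply i)

theorem convex_posOrth (n : ℕ) : Convex ℝ (posOrth n) := by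
  have : posOrth n = univ.pi fun _ => Ioi 0 := by ext; simp [posOrth]
  rw [this]
  exact convex_pi fun _ _ => convex_Ioi 0

theorem memTestClass_of_lipschitz {g : (Fin n → ℝ) → ℝ} (hg : ContDiff ℝ 5 g) {K K' : ℝ≥0}
    (hK : LipschitzWith K g) (hK' : LipschitzWith K' (fderiv ℝ g)) : MemTestClass n g where
  smooth := (hg.of_le (by norm_num)).contDiffOn
  holder4 := by
    refine ⟨1, one_pos, le_rfl, fun x hx => ?_⟩
    have h4 : ContDiff ℝ 1 (iteratedFDeriv ℝ 4 g) := hg.iteratedFDeriv_right (by norm_num)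
    obtain ⟨C, s, hs, hC⟩ := h4.contDiffAt.exists_lipschitzOnWith (x := x)
    refine ⟨s ∩ posOrth n, inter_mem hs ((isOpen_posOrth n).mem_nhds hx), inter_subset_right, C, ?_⟩
    exact (hC.mono inter_subset_left).holderOnWith
  polyGrowth := by
    refine ⟨‖g 0‖ + K + K', 1, fun x _ k hk => ?_⟩
    rw [Real.rpow_one]
    have hKx : 0 ≤ (K : ℝ) * ‖x‖ := by positivity
    have hK'x : 0 ≤ (K' : ℝ) * ‖x‖ := by positivity
    have hgx : 0 ≤ ‖g 0‖ * ‖x‖ := by positivity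
    have hg0 := norm_nonneg (g 0)
    have := K.coe_nonneg
    have := K'.coe_nonneg
    interval_cases k
    · rw [norm_iteratedFDeriv_zero]
      have h1 : ‖g x - g 0‖ ≤ K * ‖x‖ := by simpa [dist_eq_norm] using hK.dist_le_mul x 0
      have h2 := norm_le_norm_add_norm_sub' (g x) (g 0)
      linarith
    · rw [norm_iteratedFDeriv_one]
      have := norm_fderiv_le_of_lipschitz ℝ hK (x₀ := x)
      linarith
    · rw [← norm_iteratedFDeriv_fderiv, norm_iteratedFDeriv_one]
      have := norm_fderiv_le_of_lipschitz ℝ hK' (x₀ := x)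
      linarith

/-- A convex Lipschitz function that is affine near finitely many points can be smoothed to a
convex test function without changing its gradients near these points. -/
theorem exists_memTestClass_of_lipschitz {F : (Fin n → ℝ) → ℝ} {K : ℝ≥0} (hF : LipschitzWith K F)
    (hconv : ConvexOn ℝ univ F) (P : Finset (Fin n → ℝ))
    (L : (Fin n → ℝ) → (Fin n → ℝ) →L[ℝ] ℝ) (c : (Fin n → ℝ) → ℝ)
    (hP : ∀ p ∈ P, ∀ᶠ y in 𝓝 p, F y = c p + L p y) :
    ∃ g, MemTestClass n g ∧ ConvexOn ℝ univ g ∧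
      ∀ p ∈ P, ∃ c', ∀ᶠ y in 𝓝 p, g y = c' + L p y := by
  obtain ⟨r, hr, hrP⟩ : ∃ r > 0, ∀ p ∈ P, ∀ y ∈ Metric.ball p r, F y = c p + L p y := by
    have h : ∀ p ∈ P, ∀ᶠ r in 𝓝[>] (0 : ℝ), ∀ y ∈ Metric.ball p r, F y = c p + L p y := by
      intro p hp
      obtain ⟨ε, hε, hball⟩ := Metric.eventually_nhds_iff_ball.1 (hP p hp)
      filter_upwards [Ioo_mem_nhdsGT hε] with r hr y hy
      exact hball y (Metric.ball_subset_ball hr.2.le hy)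
    obtain ⟨r, hr, hr0⟩ := (((Filter.eventually_all_finset P).2 h).and self_mem_nhdsWithin).exists
    exact ⟨r, hr0, hr⟩
  let b : ContDiffBump (0 : Fin n → ℝ) := ⟨r / 4, r / 2, by positivity, by linarith⟩
  let ρ : (Fin n → ℝ) → ℝ := b.normed volume
  have hρc : Continuous ρ := b.continuous_normed
  have hρs : HasCompactSupport ρ := b.hasCompactSupport_normed
  have hρi : ∫ u, ρ u = 1 := b.integral_normed
  have hρ0 : ∀ u, 0 ≤ ρ u := fun u => b.nonneg_normed u
  have hρd : ContDiff ℝ 5 ρ := b.contDiff_normed (n := 5)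
  have hFl : LocallyIntegrable F := hF.continuous.locallyIntegrable
  let g : (Fin n → ℝ) → ℝ := ρ ⋆[ContinuousLinearMap.lsmul ℝ ℝ, volume] F
  have hex : ∀ y, Integrable fun u => ρ u * F (y - u) := fun y =>
    (hρs.convolutionExists_left (ContinuousLinearMap.lsmul ℝ ℝ) hρc hFl y).integrable
  have hgdef : ∀ y, g y = ∫ u, ρ u * F (y - u) := fun y => rfl
  obtain ⟨K₁, hK₁⟩ := lipschitzWith_convolution (μ := volume) (ContinuousLinearMap.lsmul ℝ ℝ)
    hρc hρs hF
  have hfd : fderiv ℝ g = (fderiv ℝ ρ) ⋆[(ContinuousLinearMap.lsmul ℝ ℝ).precompL (Fin n → ℝ),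
      volume] F := funext fun y =>
    (hρs.hasFDerivAt_convolution_left _ (hρd.of_le (by norm_num)) hFl y).fderiv
  obtain ⟨K₂, hK₂⟩ := lipschitzWith_convolution (μ := volume)
    ((ContinuousLinearMap.lsmul ℝ ℝ : ℝ →L[ℝ] ℝ →L[ℝ] ℝ).precompL (Fin n → ℝ))
    (hρd.continuous_fderiv (by norm_num)) (hρs.fderiv (𝕜 := ℝ)) hF
  refine ⟨g, memTestClass_of_lipschitz (hρs.contDiff_convolution_left _ hρd hFl) hK₁
    (hfd ▸ hK₂), ⟨convex_univ, fun y _ y' _ a a' ha ha' haa' => ?_⟩, fun p hp => ?_⟩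
  · simp only [hgdef, smul_eq_mul]
    rw [← integral_const_mul, ← integral_const_mul,
      ← integral_add ((hex y).const_mul a) ((hex y').const_mul a')]
    refine integral_mono (hex _) (((hex y).const_mul a).add ((hex y').const_mul a')) fun u => ?_
    have h := hconv.2 (mem_univ (y - u)) (mem_univ (y' - u)) ha ha' haa'
    have e : a • (y - u) + a' • (y' - u) = a • y + a' • y' - u := by
      rw [smul_sub, smul_sub]
      conv_rhs => rw [← one_smul ℝ u, ← haa']
      module
    rw [e] at h
    have := mul_le_mul_of_nonneg_left h (hρ0 u)
    simp only [smul_eq_mul] at this ⊢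
    linarith
  · have hLi : Integrable fun u => ρ u * L p u :=
      (hρc.mul (L p).continuous).integrable_of_hasCompactSupport (hρs.mul_right)
    have hρint : Integrable ρ := hρc.integrable_of_hasCompactSupport hρs
    refine ⟨c p - ∫ u, ρ u * L p u, ?_⟩
    filter_upwards [Metric.ball_mem_nhds p (half_pos hr)] with y hy
    have hcongr : ∀ u, ρ u * F (y - u) = ρ u * (c p + L p y) - ρ u * L p u := by
      intro u
      by_cases hu : u ∈ Metric.ball (0 : Fin n → ℝ) (r / 2)
      · have : y - u ∈ Metric.ball p r := by
          rw [Metric.mem_ball, dist_eq_norm] at *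
          calc ‖y - u - p‖ = ‖(y - p) - (u - 0)‖ := by congr 1; abel
            _ ≤ ‖y - p‖ + ‖u - 0‖ := norm_sub_le _ _
            _ < r := by linarith
        rw [hrP p hp _ this, map_sub]
        ring
      · have : ρ u = 0 := by
          rw [← Function.notMem_support]
          simpa only [ρ, b.support_normed_eq] using hu
        simp [this]
    rw [hgdef, integral_congr_ae (ae_of_all _ hcongr), integral_sub (hρint.mul_const _) hLi,
      integral_mul_const, hρi]
    ring

/-- A convex function can be replaced by a convex test function that is affine near finitely many
prescribed points and has the same gradients there. -/
theorem ConvexOn.exists_memTestClass_affine_near {f : (Fin n → ℝ) → ℝ}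
    (hf : ConvexOn ℝ (posOrth n) f) (hd : DifferentiableOn ℝ f (posOrth n))
    (P : Finset (Fin n → ℝ)) (hne : P.Nonempty) (hP : ∀ p ∈ P, p ∈ posOrth n) :
    ∃ g, MemTestClass n g ∧ ConvexOn ℝ univ g ∧
      ∀ p ∈ P, ∃ c, ∀ᶠ y in 𝓝 p, g y = c + fderiv ℝ f p y := by
  have hfd : ∀ p ∈ posOrth n, HasFDerivAt f (fderiv ℝ f p) p := fun p hp =>
    (hd.differentiableAt ((isOpen_posOrth n).mem_nhds hp)).hasFDerivAt
  let ℓ : (Fin n → ℝ) → (Fin n → ℝ) → ℝ := fun p y => (f p - fderiv ℝ f p p) + fderiv ℝ f p y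
  have hℓc : ∀ p, Continuous (ℓ p) := fun p => by fun_prop
  have hℓp : ∀ p, ℓ p p = f p := fun p => by simp [ℓ]
  have hℓle : ∀ p ∈ posOrth n, ∀ y ∈ posOrth n, ℓ p y ≤ f y := fun p hp y hy => by
    have := hf.tangent_le hp hy (hfd p hp)
    rw [map_sub] at this
    simp only [ℓ]
    linarith
  obtain ⟨⟨K, hK⟩, hconv⟩ : (∃ K, LipschitzWith K (P.sup' hne ℓ)) ∧
      ConvexOn ℝ univ (P.sup' hne ℓ) := by
    refine Finset.sup'_induction hne ℓ
      (p := fun F => (∃ K, LipschitzWith K F) ∧ ConvexOn ℝ univ F) ?_ fun p _ =>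
        ⟨⟨0 + ‖fderiv ℝ f p‖₊, ?_⟩, ?_⟩
    · rintro F₁ ⟨⟨K₁, h₁⟩, c₁⟩ F₂ ⟨⟨K₂, h₂⟩, c₂⟩
      exact ⟨⟨_, h₁.max h₂⟩, c₁.sup c₂⟩
    · exact (LipschitzWith.const (f p - fderiv ℝ f p p)).add (fderiv ℝ f p).lipschitz
    · exact (convexOn_const _ convex_univ).add ((fderiv ℝ f p).toLinearMap.convexOn convex_univ)
  refine exists_memTestClass_of_lipschitz hK hconv P (fderiv ℝ f) (fun p => f p - fderiv ℝ f p p)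
    fun p hp => ?_
  have hle : ∀ q ∈ P, ∀ᶠ y in 𝓝 p, ℓ q y ≤ ℓ p y := by
    intro q hq
    rcases (hℓle q (hP q hq) p (hP p hp)).lt_or_eq with h | h
    · rw [← hℓp p] at h
      filter_upwards [(hℓc q).continuousAt.eventually_lt (hℓc p).continuousAt h] with y hy
        using hy.le
    · have hmax : IsLocalMin (fun y => f y - ℓ q y) p := by
        filter_upwards [(isOpen_posOrth n).mem_nhds (hP p hp)] with y hy
        rw [h, sub_self]
        exact sub_nonneg.2 (hℓle q (hP q hq) y hy)
      have hd0 := hmax.hasFDerivAt_eq_zero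
        ((hfd p (hP p hp)).sub ((fderiv ℝ f q).hasFDerivAt.const_add (f q - fderiv ℝ f q q)))
      have heq := sub_eq_zero.1 hd0
      refine Eventually.of_forall fun y => ?_
      simp only [ℓ] at h ⊢
      rw [heq] at *
      linarith
  filter_upwards [(Filter.eventually_all_finset P).2 hle] with y hy
  rw [Finset.sup'_apply]
  exact le_antisymm (Finset.sup'_le _ _ fun q hq => hy q hq)
    (Finset.le_sup' (fun q => ℓ q y) hp)

end Mollification

section Interpolation

variable {E V : Type*} [NormedAddCommGroup E] [NormedSpace ℝ E] [NormedAddCommGroup V]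
  [NormedSpace ℝ V]

/-- A bounded function whose derivative stays close to a linear map `A` forces a bound on `A`. -/
theorem norm_le_of_norm_fderiv_sub_le {u : E → V} {u' : E → E →L[ℝ] V} {A : E →L[ℝ] V} {x : E}
    {r M H : ℝ} (hr : 0 < r) (hM : 0 ≤ M) (hH : 0 ≤ H)
    (hu : ∀ y ∈ Metric.ball x r, HasFDerivAt u (u' y) y)
    (hb : ∀ y ∈ Metric.ball x r, ‖u y‖ ≤ M) (hA : ∀ y ∈ Metric.ball x r, ‖u' y - A‖ ≤ H) :
    ‖A‖ ≤ 4 * M / r + H := by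
  refine A.opNorm_le_of_shell (c := (2 : ℝ)) hr (by positivity) (by norm_num) fun h hh hhr => ?_
  have hx : x ∈ Metric.ball x r := Metric.mem_ball_self hr
  have hxh : x + h ∈ Metric.ball x r := by simpa [Metric.mem_ball, dist_eq_norm] using hhr
  have h1 := (convex_ball x r).norm_image_sub_le_of_norm_hasFDerivWithin_le'
    (fun y hy => (hu y hy).hasFDerivWithinAt) hA hx hxh
  rw [add_sub_cancel_left] at h1
  have h2 : ‖A h‖ ≤ ‖u (x + h)‖ + ‖u x‖ + ‖u (x + h) - u x - A h‖ := by
    calc ‖A h‖ = ‖(u (x + h) - u x) - (u (x + h) - u x - A h)‖ := by congr 1; abel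
      _ ≤ ‖u (x + h) - u x‖ + ‖u (x + h) - u x - A h‖ := norm_sub_le _ _
      _ ≤ _ := by gcongr; exact norm_sub_le _ _
  have h3 := hb _ hx
  have h4 := hb _ hxh
  have h5 : 2 * M ≤ 4 * M / r * ‖h‖ := by
    rw [div_mul_eq_mul_div, le_div_iff₀ hr]
    norm_num at hh
    nlinarith
  linarith

/-- Interpolation: a bound on a function and on the oscillation of its second derivative over a
ball bounds its first two derivatives there. -/
theorem norm_fderiv_le_of_oscillation {φ : E → V} {x : E} {r M H : ℝ} (hr : 0 < r) (hM : 0 ≤ M)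
    (hH : 0 ≤ H) (hφ : ContDiffOn ℝ 2 φ (Metric.ball x r)) (hb : ∀ y ∈ Metric.ball x r, ‖φ y‖ ≤ M)
    (hosc : ∀ y ∈ Metric.ball x r,
      ‖fderiv ℝ (fderiv ℝ φ) y - fderiv ℝ (fderiv ℝ φ) x‖ ≤ H) {y : E} (hy : y ∈ Metric.ball x r) :
    ‖fderiv ℝ φ y‖ ≤ 4 * M / r + 2 * ((64 * M / r ^ 2 + 2 * H) * r) ∧
      ‖fderiv ℝ (fderiv ℝ φ) y‖ ≤ 64 * M / r ^ 2 + 2 * H := by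
  have hx : x ∈ Metric.ball x r := Metric.mem_ball_self hr
  have ho : IsOpen (Metric.ball x r) := Metric.isOpen_ball
  have hd1 : ∀ y ∈ Metric.ball x r, HasFDerivAt φ (fderiv ℝ φ y) y := fun y hy =>
    ((hφ.contDiffAt (ho.mem_nhds hy)).differentiableAt (by norm_num)).hasFDerivAt
  have hd2 : ∀ y ∈ Metric.ball x r, HasFDerivAt (fderiv ℝ φ) (fderiv ℝ (fderiv ℝ φ) y) y :=
    fun y hy => (((hφ.fderiv_of_isOpen ho (m := 1) (by norm_num)).contDiffAt
      (ho.mem_nhds hy)).differentiableAt (by norm_num)).hasFDerivAt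
  have hA : ‖fderiv ℝ (fderiv ℝ φ) x‖ ≤ 64 * M / r ^ 2 + H := by
    refine ContinuousLinearMap.opNorm_le_of_shell (c := (2 : ℝ)) (half_pos hr) (by positivity)
      (by norm_num) fun h hh hhr => ?_
    have hsub : ∀ y ∈ Metric.ball x (r / 2), y ∈ Metric.ball x r ∧ y + h ∈ Metric.ball x r := by
      intro y hy
      rw [Metric.mem_ball, dist_eq_norm] at *
      refine ⟨by linarith, ?_⟩
      rw [Metric.mem_ball, dist_eq_norm]
      calc ‖y + h - x‖ = ‖(y - x) + h‖ := by congr 1; abel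
        _ ≤ ‖y - x‖ + ‖h‖ := norm_add_le _ _
        _ < r := by linarith
    have key := norm_le_of_norm_fderiv_sub_le (u := fun y => φ (y + h) - φ y)
      (u' := fun y => fderiv ℝ φ (y + h) - fderiv ℝ φ y) (A := fderiv ℝ (fderiv ℝ φ) x h)
      (x := x) (M := 2 * M) (H := H * ‖h‖) (half_pos hr) (by positivity) (by positivity)
      (fun y hy => ((hasFDerivAt_comp_add_right h).2 (hd1 _ (hsub y hy).2)).sub (hd1 _ (hsub y hy).1))
      (fun y hy => (norm_sub_le _ _).trans
        (by linarith [hb _ (hsub y hy).1, hb _ (hsub y hy).2]))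
      (fun y hy => by
        have := (convex_ball x r).norm_image_sub_le_of_norm_hasFDerivWithin_le'
          (fun y hy => (hd2 y hy).hasFDerivWithinAt) hosc (hsub y hy).1 (hsub y hy).2
        rwa [add_sub_cancel_left] at this)
    refine key.trans ?_
    have : 4 * (2 * M) / (r / 2) ≤ 64 * M / r ^ 2 * ‖h‖ := by
      rw [div_mul_eq_mul_div, div_le_div_iff₀ (half_pos hr) (by positivity)]
      norm_num at hh
      have : 0 ≤ M * r * (‖h‖ - r / 4) := by
        refine mul_nonneg (by positivity) ?_
        linarith
      nlinarith
    linarith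
  have hB : ∀ y ∈ Metric.ball x r, ‖fderiv ℝ (fderiv ℝ φ) y‖ ≤ 64 * M / r ^ 2 + 2 * H := by
    intro y hy
    have h1 := norm_le_norm_add_norm_sub' (fderiv ℝ (fderiv ℝ φ) y) (fderiv ℝ (fderiv ℝ φ) x)
    have h2 := hosc y hy
    linarith
  have hB0 : 0 ≤ 64 * M / r ^ 2 + 2 * H := by positivity
  have hosc1 : ∀ y ∈ Metric.ball x r,
      ‖fderiv ℝ φ y - fderiv ℝ φ x‖ ≤ (64 * M / r ^ 2 + 2 * H) * r := by
    intro y hy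
    refine ((convex_ball x r).norm_image_sub_le_of_norm_hasFDerivWithin_le
      (fun y hy => (hd2 y hy).hasFDerivWithinAt) hB hx hy).trans ?_
    gcongr
    exact (mem_ball_iff_norm.1 hy).le
  have hD := norm_le_of_norm_fderiv_sub_le hr hM (by positivity) hd1 hb hosc1
  refine ⟨?_, hB y hy⟩
  have h1 := norm_le_norm_add_norm_sub' (fderiv ℝ φ y) (fderiv ℝ φ x)
  have h2 := hosc1 y hy
  linarith

end Interpolation

section Kernel

variable {n : ℕ} {T : ℝ}

theorem JumpKernel.add_mem_posOrth (K : JumpKernel n T) {x : Fin n → ℝ} (hx : x ∈ posOrth n)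
    {t z : ℝ} (ht : t ∈ Icc 0 T) (hz : z ∈ Icc (0 : ℝ) 1) : x + K.φ x t z ∈ posOrth n := by
  obtain ⟨γ, hγ, h⟩ := K.lower
  intro i
  have h1 := h x hx t ht z hz i
  have h2 : 0 < (1 + γ) * x i := mul_pos (by linarith) (hx i)
  rw [Pi.add_apply]
  linarith

/-- Near `x`, the jump structure and its first two derivatives are bounded uniformly in `z`, and
the arguments after a jump stay in a compact subset of the orthant. -/
theorem JumpKernel.exists_uniform_bound (K : JumpKernel n T) {x : Fin n → ℝ} (hx : x ∈ posOrth n)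
    {t : ℝ} (ht : t ∈ Icc 0 T) :
    ∃ r > 0, ∃ C, 0 ≤ C ∧ ∃ Q, IsCompact Q ∧ Q ⊆ posOrth n ∧ Metric.ball x r ⊆ Q ∧
      ∀ z ∈ Icc (0 : ℝ) 1, ∀ y ∈ Metric.ball x r, y + K.φ y t z ∈ Q ∧ ‖K.φ y t z‖ ≤ C ∧
        ‖fderiv ℝ (fun y => K.φ y t z) y‖ ≤ C ∧
        ‖fderiv ℝ (fderiv ℝ (fun y => K.φ y t z)) y‖ ≤ C := by
  obtain ⟨α, hα, -, hH⟩ := K.holder2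
  obtain ⟨s, hs, hsO, H, hH⟩ := hH t ht x hx
  obtain ⟨D, hD, hbd⟩ := K.bound
  obtain ⟨γ, hγ, hlow⟩ := K.lower
  have hbox : ∀ᶠ y in 𝓝 x, ∀ i, x i / 2 < y i ∧ y i < 2 * x i := by
    rw [eventually_all]
    intro i
    have hi := hx i
    exact ((continuous_apply i).tendsto x).eventually
      (Ioo_mem_nhds (by linarith) (by linarith))
  obtain ⟨r₀, hr₀, hball⟩ := Metric.mem_nhds_iff.1 (inter_mem hs hbox)
  have hr : 0 < min r₀ 1 := lt_min hr₀ one_pos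
  have hsub : ∀ y ∈ Metric.ball x (min r₀ 1), y ∈ s ∧ ∀ i, x i / 2 < y i ∧ y i < 2 * x i :=
    fun y hy => hball (Metric.ball_subset_ball (min_le_left _ _) hy)
  have habs : ∀ z ∈ Icc (0 : ℝ) 1, ∀ y ∈ Metric.ball x (min r₀ 1), ∀ i,
      |K.φ y t z i| ≤ (D + 1) * (2 * x i) := by
    intro z hz y hy i
    have hy0 := hsO (hsub y hy).1 i
    have h1 := hbd y (hsO (hsub y hy).1) t ht z hz i
    have h2 : |K.φ y t z i| ≤ (D + 1) * y i := by
      refine abs_le_of_sq_le_sq (h1.trans ?_) (by positivity)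
      rw [mul_pow]
      have : 0 < (y i) ^ 2 := by positivity
      nlinarith [mul_pos hD this, mul_pos (mul_pos hD hD) this]
    refine h2.trans ?_
    have := ((hsub y hy).2 i).2
    gcongr
  have hφb : ∀ z ∈ Icc (0 : ℝ) 1, ∀ y ∈ Metric.ball x (min r₀ 1),
      ‖K.φ y t z‖ ≤ (D + 1) * (2 * ‖x‖) := by
    intro z hz y hy
    refine (pi_norm_le_iff_of_nonneg (by positivity)).2 fun i => (habs z hz y hy i).trans ?_
    have : x i ≤ ‖x‖ := (le_abs_self _).trans (norm_le_pi_norm x i)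
    gcongr
  have hosc : ∀ z ∈ Icc (0 : ℝ) 1, ∀ y ∈ Metric.ball x (min r₀ 1),
      ‖fderiv ℝ (fderiv ℝ (fun y => K.φ y t z)) y
        - fderiv ℝ (fderiv ℝ (fun y => K.φ y t z)) x‖ ≤ H := by
    intro z hz y hy
    have hd := (hH z hz).dist_le_of_le (hsub y hy).1 (mem_of_mem_nhds hs)
      ((Metric.mem_ball.1 hy).le.trans (min_le_right r₀ 1))
    rw [Real.one_rpow, mul_one, dist_eq_norm] at hd
    refine ContinuousLinearMap.opNorm_le_bound₂ _ H.coe_nonneg fun a b => ?_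
    have happ : (fderiv ℝ (fderiv ℝ (fun y => K.φ y t z)) y
        - fderiv ℝ (fderiv ℝ (fun y => K.φ y t z)) x) a b
        = (iteratedFDeriv ℝ 2 (fun y => K.φ y t z) y
          - iteratedFDeriv ℝ 2 (fun y => K.φ y t z) x) ![a, b] := by
      simp [iteratedFDeriv_two_apply]
    rw [happ]
    refine (ContinuousMultilinearMap.le_of_opNorm_le hd _).trans_eq ?_
    simp [Fin.prod_univ_two, mul_assoc]
  have hbd' := fun z hz y hy => norm_fderiv_le_of_oscillation hr
    (by positivity : 0 ≤ (D + 1) * (2 * ‖x‖)) H.coe_nonneg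
    ((K.smooth t ht z hz).mono fun y hy => hsO (hsub y hy).1) (hφb z hz) (hosc z hz) (y := y) hy
  refine ⟨min r₀ 1, hr, _, ?_, Icc (fun i => min (x i / 2) ((1 + γ) * (x i / 2)))
    (fun i => 2 * x i + (D + 1) * (2 * x i)), isCompact_Icc, ?_, ?_, fun z hz y hy =>
      ⟨?_, ((hφb z hz y hy).trans (le_max_left _ _)).trans (le_max_left _ _),
        ((hbd' z hz y hy).1.trans (le_max_right _ _)).trans (le_max_left _ _),
        (hbd' z hz y hy).2.trans (le_max_right _ _)⟩⟩
  · exact le_max_of_le_left (le_max_of_le_left (by positivity))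
  · intro y hy i
    have hi := hx i
    exact (lt_min (by positivity) (mul_pos (by linarith) (by positivity))).trans_le (hy.1 i)
  · intro y hy
    have h := (hsub y hy).2
    refine ⟨fun i => (min_le_left _ _).trans (h i).1.le, fun i => ?_⟩
    have := hx i
    have : 0 ≤ (D + 1) * (2 * x i) := by positivity
    have := (h i).2
    simp only
    linarith
  · have h := (hsub y hy).2
    refine ⟨fun i => (min_le_right _ _).trans ?_, fun i => ?_⟩
    · have h1 := hlow y (hsO (hsub y hy).1) t ht z hz i
      have h2 : (1 + γ) * (x i / 2) ≤ (1 + γ) * y i :=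
        mul_le_mul_of_nonneg_left (h i).1.le (by linarith)
      simp only [Pi.add_apply]
      linarith
    · have h1 := (le_abs_self _).trans (habs z hz y hy i)
      have h2 := (h i).2
      simp only [Pi.add_apply]
      linarith

end Kernel

section JumpIntegrand

variable {E : Type*} [NormedAddCommGroup E] [NormedSpace ℝ E]

/-- The first derivative of `y ↦ f (y + ψ y) - f y - f' y (ψ y)`. -/
def jumpFDeriv (f : E → ℝ) (ψ : E → E) (y : E) : E →L[ℝ] ℝ :=
  (fderiv ℝ f (y + ψ y)).comp (ContinuousLinearMap.id ℝ E + fderiv ℝ ψ y) - fderiv ℝ f y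
    - ((fderiv ℝ f y).comp (fderiv ℝ ψ y) + (fderiv ℝ (fderiv ℝ f) y).flip (ψ y))

/-- The derivative of `y ↦ jumpFDeriv f ψ y v`. -/
def jumpFDeriv₂ (f : E → ℝ) (ψ : E → E) (v y : E) : E →L[ℝ] ℝ :=
  (fderiv ℝ f (y + ψ y)).comp ((fderiv ℝ (fderiv ℝ ψ) y).flip v)
    + ((fderiv ℝ (fderiv ℝ f) (y + ψ y)).comp
      (ContinuousLinearMap.id ℝ E + fderiv ℝ ψ y)).flip (v + fderiv ℝ ψ y v)
    - (fderiv ℝ (fderiv ℝ f) y).flip v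
    - (((fderiv ℝ f y).comp ((fderiv ℝ (fderiv ℝ ψ) y).flip v)
        + (fderiv ℝ (fderiv ℝ f) y).flip (fderiv ℝ ψ y v))
      + ((fderiv ℝ (fderiv ℝ f) y v).comp (fderiv ℝ ψ y)
        + ((fderiv ℝ (fderiv ℝ (fderiv ℝ f)) y).flip v).flip (ψ y)))

variable {f : E → ℝ} {ψ : E → E} {s : Set E} {v y : E}

theorem hasFDerivAt_clm_apply_const {F : Type*} [NormedAddCommGroup F] [NormedSpace ℝ F]
    {c : E → E →L[ℝ] F} {c' : E →L[ℝ] E →L[ℝ] F} (hc : HasFDerivAt c c' y) (v : E) :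
    HasFDerivAt (fun y => c y v) (c'.flip v) y := by
  simpa using hc.clm_apply (hasFDerivAt_const v y)

theorem hasFDerivAt_jump (hs : IsOpen s) (hf : ContDiffOn ℝ 3 f s) (hψ : ContDiffOn ℝ 2 ψ s)
    (hy : y ∈ s) (hyψ : y + ψ y ∈ s) :
    HasFDerivAt (fun y => f (y + ψ y) - f y - fderiv ℝ f y (ψ y)) (jumpFDeriv f ψ y) y ∧
      HasFDerivAt (fun y => jumpFDeriv f ψ y v) (jumpFDeriv₂ f ψ v y) y := by
  have hf1 : ContDiffOn ℝ 2 (fderiv ℝ f) s := hf.fderiv_of_isOpen hs (by norm_num)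
  have hf2 : ContDiffOn ℝ 1 (fderiv ℝ (fderiv ℝ f)) s := hf1.fderiv_of_isOpen hs (by norm_num)
  have hψ1 : ContDiffOn ℝ 1 (fderiv ℝ ψ) s := hψ.fderiv_of_isOpen hs (by norm_num)
  have d0 : ∀ p ∈ s, HasFDerivAt f (fderiv ℝ f p) p := fun p hp =>
    ((hf.contDiffAt (hs.mem_nhds hp)).differentiableAt (by norm_num)).hasFDerivAt
  have d1 : ∀ p ∈ s, HasFDerivAt (fderiv ℝ f) (fderiv ℝ (fderiv ℝ f) p) p := fun p hp =>
    ((hf1.contDiffAt (hs.mem_nhds hp)).differentiableAt (by norm_num)).hasFDerivAt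
  have d2 : HasFDerivAt (fderiv ℝ (fderiv ℝ f)) (fderiv ℝ (fderiv ℝ (fderiv ℝ f)) y) y :=
    ((hf2.contDiffAt (hs.mem_nhds hy)).differentiableAt (by norm_num)).hasFDerivAt
  have e0 : HasFDerivAt ψ (fderiv ℝ ψ y) y :=
    ((hψ.contDiffAt (hs.mem_nhds hy)).differentiableAt (by norm_num)).hasFDerivAt
  have e1 : HasFDerivAt (fderiv ℝ ψ) (fderiv ℝ (fderiv ℝ ψ) y) y :=
    ((hψ1.contDiffAt (hs.mem_nhds hy)).differentiableAt (by norm_num)).hasFDerivAt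
  have hP : HasFDerivAt (fun y => y + ψ y) (ContinuousLinearMap.id ℝ E + fderiv ℝ ψ y) y :=
    (hasFDerivAt_id y).add e0
  constructor
  · exact ((HasFDerivAt.comp (f := fun y => y + ψ y) y (d0 _ hyψ) hP).sub (d0 y hy)).sub
      ((d1 y hy).clm_apply e0)
  · have e1v : HasFDerivAt (fun y => fderiv ℝ ψ y v) ((fderiv ℝ (fderiv ℝ ψ) y).flip v) y :=
      hasFDerivAt_clm_apply_const e1 v
    have e1v' : HasFDerivAt (fun y => v + fderiv ℝ ψ y v) ((fderiv ℝ (fderiv ℝ ψ) y).flip v) y :=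
      e1v.const_add v
    have a1 := (HasFDerivAt.comp (f := fun y => y + ψ y) y (d1 _ hyψ) hP).clm_apply e1v'
    have a2 := hasFDerivAt_clm_apply_const (d1 y hy) v
    have a3 := (d1 y hy).clm_apply e1v
    have a4 := (hasFDerivAt_clm_apply_const d2 v).clm_apply e0
    exact (a1.sub a2).sub (a3.add a4)

theorem norm_jumpFDeriv_le {C : ℝ} (hC : 0 ≤ C) (h0 : ‖ψ y‖ ≤ C) (h1 : ‖fderiv ℝ ψ y‖ ≤ C)
    (f1 : ‖fderiv ℝ f y‖ ≤ C) (f2 : ‖fderiv ℝ (fderiv ℝ f) y‖ ≤ C)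
    (g1 : ‖fderiv ℝ f (y + ψ y)‖ ≤ C) :
    ‖jumpFDeriv f ψ y‖ ≤ C * (1 + C) + C + (C * C + C * C) := by
  have hid : ‖ContinuousLinearMap.id ℝ E + fderiv ℝ ψ y‖ ≤ 1 + C :=
    (norm_add_le _ _).trans (add_le_add ContinuousLinearMap.norm_id_le h1)
  refine (norm_sub_le _ _).trans (add_le_add ((norm_sub_le _ _).trans (add_le_add ?_ f1))
    ((norm_add_le _ _).trans (add_le_add ?_ ?_)))
  · exact (ContinuousLinearMap.opNorm_comp_le _ _).trans (by gcongr)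
  · exact (ContinuousLinearMap.opNorm_comp_le _ _).trans (by gcongr)
  · refine (ContinuousLinearMap.le_opNorm _ _).trans ?_
    rw [ContinuousLinearMap.opNorm_flip]
    gcongr

theorem norm_flip_apply_le {F : Type*} [NormedAddCommGroup F] [NormedSpace ℝ F]
    (B : E →L[ℝ] E →L[ℝ] F) (c d : ℝ) (w : E) (hB : ‖B‖ ≤ c) (hw : ‖w‖ ≤ d) :
    ‖B.flip w‖ ≤ c * d :=
  ContinuousLinearMap.le_of_opNorm_le_of_le _ ((ContinuousLinearMap.opNorm_flip B).trans_le hB) hw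

theorem norm_comp_le_mul {F : Type*} [NormedAddCommGroup F] [NormedSpace ℝ F]
    (A : E →L[ℝ] F) (B : E →L[ℝ] E) (c d : ℝ) (hA : ‖A‖ ≤ c) (hB : ‖B‖ ≤ d) :
    ‖A.comp B‖ ≤ c * d :=
  (ContinuousLinearMap.opNorm_comp_le _ _).trans
    (mul_le_mul hA hB (norm_nonneg _) ((norm_nonneg _).trans hA))

set_option maxSynthPendingDepth 6 in
theorem norm_jumpFDeriv₂_le {C : ℝ} (h0 : ‖ψ y‖ ≤ C) (h1 : ‖fderiv ℝ ψ y‖ ≤ C)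
    (h2 : ‖fderiv ℝ (fderiv ℝ ψ) y‖ ≤ C)
    (f1 : ‖fderiv ℝ f y‖ ≤ C) (f2 : ‖fderiv ℝ (fderiv ℝ f) y‖ ≤ C)
    (f3 : ‖fderiv ℝ (fderiv ℝ (fderiv ℝ f)) y‖ ≤ C)
    (g1 : ‖fderiv ℝ f (y + ψ y)‖ ≤ C) (g2 : ‖fderiv ℝ (fderiv ℝ f) (y + ψ y)‖ ≤ C) :
    ‖jumpFDeriv₂ f ψ v y‖ ≤ C * (C * ‖v‖) + C * (1 + C) * (‖v‖ + C * ‖v‖) + C * ‖v‖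
      + ((C * (C * ‖v‖) + C * (C * ‖v‖)) + (C * ‖v‖ * C + C * ‖v‖ * C)) := by
  have hid : ‖ContinuousLinearMap.id ℝ E + fderiv ℝ ψ y‖ ≤ 1 + C :=
    (norm_add_le _ _).trans (add_le_add ContinuousLinearMap.norm_id_le h1)
  have hψv : ‖fderiv ℝ ψ y v‖ ≤ C * ‖v‖ := ContinuousLinearMap.le_of_opNorm_le _ h1 v
  have hψ2 := norm_flip_apply_le (fderiv ℝ (fderiv ℝ ψ) y) C ‖v‖ v h2 le_rfl
  refine (norm_sub_le _ _).trans (add_le_add ((norm_sub_le _ _).trans (add_le_add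
    ((norm_add_le _ _).trans (add_le_add ?_ ?_)) ?_))
    ((norm_add_le _ _).trans (add_le_add ((norm_add_le _ _).trans (add_le_add ?_ ?_))
      ((norm_add_le _ _).trans (add_le_add ?_ ?_)))))
  · exact norm_comp_le_mul _ _ _ _ g1 hψ2
  · exact norm_flip_apply_le _ _ _ _ (norm_comp_le_mul _ _ _ _ g2 hid) ((norm_add_le _ _).trans (by gcongr))
  · exact norm_flip_apply_le _ _ _ _ f2 le_rfl
  · exact norm_comp_le_mul _ _ _ _ f1 hψ2
  · exact norm_flip_apply_le _ _ _ _ f2 hψv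
  · exact norm_comp_le_mul _ _ _ _ (ContinuousLinearMap.le_of_opNorm_le _ f2 v) h1
  · exact norm_flip_apply_le _ _ _ _ (norm_flip_apply_le _ _ _ _ f3 le_rfl) h0

/-- At a point where a convex `f` has vanishing second derivative in direction `v`, only the terms
evaluated after the jump survive in the second derivative of the jump integrand. -/
theorem jumpFDeriv₂_apply_self (hs : IsOpen s) (hconv : ConvexOn ℝ s f) (hf : ContDiffOn ℝ 3 f s)
    (hy : y ∈ s) (hyψ : y + ψ y ∈ s) (hv : fderiv ℝ (fderiv ℝ f) y v v = 0) :
    jumpFDeriv₂ f ψ v y v = fderiv ℝ (fderiv ℝ f) (y + ψ y) v v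
      + 2 * fderiv ℝ (fderiv ℝ f) (y + ψ y) (fderiv ℝ ψ y v) v
      + fderiv ℝ (fderiv ℝ f) (y + ψ y) (fderiv ℝ ψ y v) (fderiv ℝ ψ y v)
      + (fderiv ℝ f (y + ψ y) (fderiv ℝ (fderiv ℝ ψ) y v v)
        - fderiv ℝ f y (fderiv ℝ (fderiv ℝ ψ) y v v)) := by
  have hsymm : ∀ p ∈ s, ∀ a b, fderiv ℝ (fderiv ℝ f) p a b = fderiv ℝ (fderiv ℝ f) p b a :=
    fun p hp => (hf.contDiffAt (hs.mem_nhds hp)).isSymmSndFDerivAt (by simp; norm_num)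
  have hker : ∀ w, fderiv ℝ (fderiv ℝ f) y v w = 0 :=
    ContinuousLinearMap.apply_eq_zero_of_psd (hsymm y hy)
      (hconv.fderiv_fderiv_nonneg hs (hf.of_le (by norm_num)) hy) hv
  have h3 := hconv.third_deriv_eq_zero hs hf hy hv (ψ y)
  simp only [jumpFDeriv₂, _root_.add_apply, _root_.sub_apply, ContinuousLinearMap.comp_apply,
    ContinuousLinearMap.flip_apply, map_add, ContinuousLinearMap.id_apply, hker, h3,
    hsymm _ hyψ v (fderiv ℝ ψ y v)]
  ring

end JumpIntegrand

section JumpOperator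

variable {n : ℕ} {T : ℝ} {f : (Fin n → ℝ) → ℝ} {x v : Fin n → ℝ} {t : ℝ}

theorem dmix_eq_fderiv_fderiv {F : Type*} [NormedAddCommGroup F] [NormedSpace ℝ F]
    {f : (Fin n → ℝ) → F} (hf : DifferentiableAt ℝ (fderiv ℝ f) x) (a b : Fin n → ℝ) :
    dmix f x a b = fderiv ℝ (fderiv ℝ f) x b a := by
  rw [dmix, (hasFDerivAt_clm_apply_const hf.hasFDerivAt a).fderiv,
    ContinuousLinearMap.flip_apply]

theorem dir2_const_smul (c : ℝ) (g : (Fin n → ℝ) → ℝ) (x v : Fin n → ℝ) :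
    dir2 (fun y => c • g y) x v = c • dir2 g x v := by
  have h : ∀ u : (Fin n → ℝ) → ℝ, ∀ y w,
      fderiv ℝ (fun y => c • u y) y w = c • fderiv ℝ u y w := fun u y w =>
    congrFun (congrArg DFunLike.coe (congrFun (fderiv_const_smul_field (f := u) c) y)) w
  simp only [dir2, dmix, h]

theorem differentiableAt_fderiv_of_contDiffOn {F : Type*} [NormedAddCommGroup F]
    [NormedSpace ℝ F] {f : (Fin n → ℝ) → F} (hf : ContDiffOn ℝ 2 f (posOrth n))
    (hx : x ∈ posOrth n) : DifferentiableAt ℝ (fderiv ℝ f) x :=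
  ((hf.fderiv_of_isOpen (m := 1) (isOpen_posOrth n) (by norm_num)).contDiffAt
    ((isOpen_posOrth n).mem_nhds hx)).differentiableAt (by norm_num)

/-- `ohlyIntegrand` in terms of iterated Fréchet derivatives. -/
theorem ohlyIntegrand_eq (K : JumpKernel n T) (hf : ContDiffOn ℝ 2 f (posOrth n))
    (hx : x ∈ posOrth n) (ht : t ∈ Icc 0 T) {z : ℝ} (hz : z ∈ Icc (0 : ℝ) 1) :
    ohlyIntegrand K f x v t z =
      fderiv ℝ (fderiv ℝ f) (x + K.φ x t z) (v + dir1 (fun y => K.φ y t z) x v)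
        (v + dir1 (fun y => K.φ y t z) x v)
      + (fderiv ℝ f (x + K.φ x t z) (dir2 (fun y => K.φ y t z) x v)
        - fderiv ℝ f x (dir2 (fun y => K.φ y t z) x v)) := by
  have hp := K.add_mem_posOrth hx ht hz
  have hsymm : ∀ a b, fderiv ℝ (fderiv ℝ f) (x + K.φ x t z) a b
      = fderiv ℝ (fderiv ℝ f) (x + K.φ x t z) b a :=
    (hf.contDiffAt ((isOpen_posOrth n).mem_nhds hp)).isSymmSndFDerivAt (by simp)
  simp only [ohlyIntegrand, dmix_eq_fderiv_fderiv (differentiableAt_fderiv_of_contDiffOn hf hp),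
    map_add, _root_.add_apply, hsymm v]
  ring

theorem JumpKernel.aestronglyMeasurable_jump (K : JumpKernel n T)
    (hf : ContinuousOn f (posOrth n)) (hx : x ∈ posOrth n) (ht : t ∈ Icc 0 T) :
    AEStronglyMeasurable (fun z => f (x + K.φ x t z) - f x - fderiv ℝ f x (K.φ x t z))
      (volume.restrict (Icc (0 : ℝ) 1)) := by
  have hφ := K.meas x hx t ht
  have h1 : AEStronglyMeasurable (fun z => f (x + K.φ x t z))
      (volume.restrict (Icc (0 : ℝ) 1)) := by
    have hm : Measurable ((posOrth n).indicator f) := by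
      classical
      rw [← Set.piecewise_eq_indicator]
      exact hf.measurable_piecewise continuousOn_const (isOpen_posOrth n).measurableSet
    refine (hm.comp (hφ.const_add x)).aestronglyMeasurable.congr ?_
    refine ae_restrict_of_forall_mem measurableSet_Icc fun z hz => ?_
    exact Set.indicator_of_mem (K.add_mem_posOrth hx ht hz) f
  exact (h1.sub aestronglyMeasurable_const).sub
    ((fderiv ℝ f x).continuous.measurable.comp hφ).aestronglyMeasurable

set_option maxSynthPendingDepth 6 in
/-- At a point where a convex test function has vanishing second derivative in direction `v`,
`∂_v² (B f)` is the integral of `ohlyIntegrand`. -/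
theorem dir2_Bop (K : JumpKernel n T) (lam : ℝ → ℝ) (hf : ContDiffOn ℝ 4 f (posOrth n))
    (hconv : ConvexOn ℝ (posOrth n) f) (hx : x ∈ posOrth n) (ht : t ∈ Icc 0 T)
    (hv : dir2 f x v = 0) :
    IntegrableOn (fun z => ohlyIntegrand K f x v t z) (Icc 0 1) ∧
      dir2 (fun y => Bop lam K f y t) x v =
        lam t * ∫ z in Icc (0 : ℝ) 1, ohlyIntegrand K f x v t z := by
  have hs := isOpen_posOrth n
  have hf1 : ContDiffOn ℝ 3 (fderiv ℝ f) (posOrth n) := hf.fderiv_of_isOpen hs (by norm_num)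
  have hf2 : ContDiffOn ℝ 2 (fderiv ℝ (fderiv ℝ f)) (posOrth n) :=
    hf1.fderiv_of_isOpen hs (by norm_num)
  have hf3 : ContDiffOn ℝ 1 (fderiv ℝ (fderiv ℝ (fderiv ℝ f))) (posOrth n) :=
    hf2.fderiv_of_isOpen hs (by norm_num)
  have hf' : ContDiffOn ℝ 3 f (posOrth n) := hf.of_le (by norm_num)
  obtain ⟨r, hr, C, hC, Q, hQ, hQs, hball, hK⟩ := K.exists_uniform_bound hx ht
  obtain ⟨c0, h0⟩ := hQ.exists_bound_of_continuousOn (hf.continuousOn.mono hQs)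
  obtain ⟨c1, h1⟩ := hQ.exists_bound_of_continuousOn (hf1.continuousOn.mono hQs)
  obtain ⟨c2, h2⟩ := hQ.exists_bound_of_continuousOn (hf2.continuousOn.mono hQs)
  obtain ⟨c3, h3⟩ := hQ.exists_bound_of_continuousOn (hf3.continuousOn.mono hQs)
  obtain ⟨M, hCM, h0M, h1M, h2M, h3M⟩ : ∃ M, C ≤ M ∧ c0 ≤ M ∧ c1 ≤ M ∧ c2 ≤ M ∧ c3 ≤ M :=
    ⟨max C (max c0 (max c1 (max c2 c3))), by simp, by simp, by simp, by simp, by simp⟩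
  have hM : 0 ≤ M := hC.trans hCM
  have hae : ∀ {p : ℝ → Prop}, (∀ z ∈ Icc (0 : ℝ) 1, p z) →
      ∀ᵐ z ∂(volume.restrict (Icc (0 : ℝ) 1)), p z :=
    fun h => ae_restrict_of_forall_mem measurableSet_Icc h
  have hder := fun z (hz : z ∈ Icc (0 : ℝ) 1) y (hy : y ∈ Metric.ball x r) =>
    hasFDerivAt_jump (v := v) hs hf' (K.smooth t ht z hz) (hQs (hball hy)) (hQs (hK z hz y hy).1)
  obtain ⟨hint, heq⟩ := dir2_integral_of_bounded (μ := volume.restrict (Icc (0 : ℝ) 1))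
    (G := fun y z => f (y + K.φ y t z) - f y - fderiv ℝ f y (K.φ y t z))
    (G' := fun y z => jumpFDeriv f (fun y => K.φ y t z) y)
    (G'' := fun y z => jumpFDeriv₂ f (fun y => K.φ y t z) v y)
    (v := v) (C := M + M + M * M) Metric.isOpen_ball
    (fun y hy => K.aestronglyMeasurable_jump hf.continuousOn (hQs (hball hy)) ht)
    (hae fun z hz y hy => (hder z hz y hy).1) (hae fun z hz y hy => (hder z hz y hy).2)
    (hae fun z hz y hy => by
      obtain ⟨k1, k2, -, -⟩ := hK z hz y hy
      exact (norm_sub_le _ _).trans (add_le_add ((norm_sub_le _ _).trans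
        (add_le_add ((h0 _ k1).trans h0M) ((h0 _ (hball hy)).trans h0M)))
        (ContinuousLinearMap.le_of_opNorm_le_of_le _ ((h1 _ (hball hy)).trans h1M)
          (k2.trans hCM))))
    (hae fun z hz y hy => by
      obtain ⟨k1, k2, k3, -⟩ := hK z hz y hy
      exact norm_jumpFDeriv_le hM (k2.trans hCM) (k3.trans hCM) ((h1 _ (hball hy)).trans h1M)
        ((h2 _ (hball hy)).trans h2M) ((h1 _ k1).trans h1M))
    (hae fun z hz y hy => by
      obtain ⟨k1, k2, k3, k4⟩ := hK z hz y hy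
      exact norm_jumpFDeriv₂_le (k2.trans hCM) (k3.trans hCM) (k4.trans hCM)
        ((h1 _ (hball hy)).trans h1M) ((h2 _ (hball hy)).trans h2M)
        ((h3 _ (hball hy)).trans h3M) ((h1 _ k1).trans h1M) ((h2 _ k1).trans h2M))
    (Metric.mem_ball_self hr)
  have hv' : fderiv ℝ (fderiv ℝ f) x v v = 0 := by
    rwa [dir2, dmix_eq_fderiv_fderiv
      (differentiableAt_fderiv_of_contDiffOn (hf.of_le (by norm_num)) hx)] at hv
  have hG : ∀ z ∈ Icc (0 : ℝ) 1, jumpFDeriv₂ f (fun y => K.φ y t z) v x v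
      = ohlyIntegrand K f x v t z := by
    intro z hz
    have hp := K.add_mem_posOrth hx ht hz
    rw [jumpFDeriv₂_apply_self hs hconv hf' hx hp hv', ohlyIntegrand, dir2,
      dmix_eq_fderiv_fderiv (differentiableAt_fderiv_of_contDiffOn (K.smooth t ht z hz) hx)]
    simp only [dir1,
      dmix_eq_fderiv_fderiv (differentiableAt_fderiv_of_contDiffOn (hf.of_le (by norm_num)) hp)]
  refine ⟨hint.congr (hae hG), ?_⟩
  rw [← setIntegral_congr_fun measurableSet_Icc hG, ← heq]
  exact dir2_const_smul _ _ x v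

end JumpOperator

section Equivalence

variable {n : ℕ} {T : ℝ} {f : (Fin n → ℝ) → ℝ} {x v : Fin n → ℝ} {t : ℝ}

/-- When the jump sizes at `(x, t)` take finitely many values, `f` can be replaced by a convex test
function for which `ohlyIntegrand` reduces to its last term. -/
theorem exists_memTestClass_ohlyIntegrand_eq (K : JumpKernel n T)
    (hfin : ((fun z => K.φ x t z) '' Icc (0 : ℝ) 1).Finite) (hf : ContDiffOn ℝ 4 f (posOrth n))
    (hconv : ConvexOn ℝ (posOrth n) f) (hx : x ∈ posOrth n) (ht : t ∈ Icc 0 T) :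
    ∃ g, MemTestClass n g ∧ ConvexOn ℝ (posOrth n) g ∧ (∀ v, dir2 g x v = 0) ∧
      ∀ v, ∀ z ∈ Icc (0 : ℝ) 1, ohlyIntegrand K g x v t z =
        fderiv ℝ f (x + K.φ x t z) (dir2 (fun y => K.φ y t z) x v)
          - fderiv ℝ f x (dir2 (fun y => K.φ y t z) x v) := by
  classical
  obtain ⟨g, hg, hgc, hgP⟩ := hconv.exists_memTestClass_affine_near
    (hf.differentiableOn (by norm_num)) (insert x (hfin.toFinset.image (x + ·)))
    (Finset.insert_nonempty _ _) (by
      intro p hp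
      simp only [Finset.mem_insert, Finset.mem_image, Set.Finite.mem_toFinset, Set.mem_image] at hp
      obtain rfl | ⟨_, ⟨z, hz, rfl⟩, rfl⟩ := hp
      exacts [hx, K.add_mem_posOrth hx ht hz])
  have hder : ∀ p, (∃ c, ∀ᶠ y in 𝓝 p, g y = c + fderiv ℝ f p y) →
      fderiv ℝ g p = fderiv ℝ f p ∧ fderiv ℝ (fderiv ℝ g) p = 0 := by
    rintro p ⟨c, hc⟩
    have h1 : fderiv ℝ g =ᶠ[𝓝 p] fun _ => fderiv ℝ f p := by
      refine (Filter.EventuallyEq.fderiv hc).trans (Eventually.of_forall fun y => ?_)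
      exact ((fderiv ℝ f p).hasFDerivAt.const_add c).fderiv
    exact ⟨h1.eq_of_nhds, by rw [h1.fderiv_eq, fderiv_fun_const]; rfl⟩
  have hx' := hder x (hgP x (Finset.mem_insert_self _ _))
  have hg2 : ContDiffOn ℝ 2 g (posOrth n) := hg.smooth.of_le (by norm_num)
  refine ⟨g, hg, hgc.subset (subset_univ _) (convex_posOrth n), fun v => ?_, fun v z hz => ?_⟩
  · rw [dir2, dmix_eq_fderiv_fderiv (differentiableAt_fderiv_of_contDiffOn hg2 hx), hx'.2]
    rfl
  · have hz' := hder (x + K.φ x t z) (hgP _ (Finset.mem_insert_of_mem (Finset.mem_image_of_mem _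
      (hfin.mem_toFinset.2 (mem_image_of_mem _ hz)))))
    rw [ohlyIntegrand_eq K hg2 hx ht hz, hz'.1, hz'.2, hx'.1]
    simp

end Equivalence

/-- Theorem 6.1: assume that for each fixed `(x,t)` the map `z ↦ φ(x,t,z)` takes at most
finitely many values. Then, at any `(x,t) ∈ (0,∞)ⁿ × [0,T]`, the following are
equivalent: (i) `B` is LCP at `(x,t)`; (ii) condition (ohly) holds for all directions
`v ≠ 0` and all convex `f ∈ F` with `∂_v²f(x) = 0`; (iii) condition (cond) holds for all
directions `v ≠ 0` and all convex `f ∈ F`. -/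
theorem lcp_iff_ohly_iff_cond_of_finite {n : ℕ} {T : ℝ} (hT : 0 < T)
    (K : JumpKernel n T) (hK : K.AENonzero)
    (hfin : ∀ x ∈ posOrth n, ∀ t ∈ Set.Icc (0:ℝ) T,
      ((fun z => K.φ x t z) '' Set.Icc (0:ℝ) 1).Finite)
    (lam : ℝ → ℝ) (hlam : LamOK T lam)
    (hlampos : ∀ s ∈ Set.Icc (0:ℝ) T, 0 < lam s)
    (x : Fin n → ℝ) (hx : x ∈ posOrth n)
    (t : ℝ) (ht : t ∈ Set.Icc (0:ℝ) T) :
    (IsLCPAt (Bop lam K) x t ↔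
      ∀ v : Fin n → ℝ, v ≠ 0 → ∀ f : (Fin n → ℝ) → ℝ,
        MemTestClass n f → ConvexOn ℝ (posOrth n) f → dir2 f x v = 0 →
        0 ≤ ∫ z in Icc (0:ℝ) 1, ohlyIntegrand K f x v t z) ∧
    (IsLCPAt (Bop lam K) x t ↔
      ∀ v : Fin n → ℝ, v ≠ 0 → ∀ f : (Fin n → ℝ) → ℝ,
        MemTestClass n f → ConvexOn ℝ (posOrth n) f →
        0 ≤ ∫ z in Icc (0:ℝ) 1,
          (fderiv ℝ f (x + K.φ x t z) (dir2 (fun y => K.φ y t z) x v)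
            - fderiv ℝ f x (dir2 (fun y => K.φ y t z) x v))) := by
  have hlam_t := hlampos t ht
  have hB : IsLCPAt (Bop lam K) x t ↔
      ∀ v : Fin n → ℝ, v ≠ 0 → ∀ f : (Fin n → ℝ) → ℝ,
        MemTestClass n f → ConvexOn ℝ (posOrth n) f → dir2 f x v = 0 →
        0 ≤ ∫ z in Icc (0:ℝ) 1, ohlyIntegrand K f x v t z := by
    refine forall₂_congr fun v _ => forall₄_congr fun f hf hc h0 => ?_
    rw [(dir2_Bop K lam hf.smooth hc hx ht h0).2, mul_nonneg_iff_of_pos_left hlam_t]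
  refine ⟨hB, hB.trans ⟨fun h v hv f hf hc => ?_, fun h v hv f hf hc h0 => ?_⟩⟩
  · obtain ⟨g, hg, hgc, hg0, hgeq⟩ :=
      exists_memTestClass_ohlyIntegrand_eq K (hfin x hx t ht) hf.smooth hc hx ht
    rw [← setIntegral_congr_fun measurableSet_Icc (hgeq v)]
    exact h v hv g hg hgc (hg0 v)
  · obtain ⟨g, hg, hgc, hg0, hgeq⟩ :=
      exists_memTestClass_ohlyIntegrand_eq K (hfin x hx t ht) hf.smooth hc hx ht
    refine (h v hv f hf hc).trans ?_
    rw [← setIntegral_congr_fun measurableSet_Icc (hgeq v)]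
    refine setIntegral_mono_on (dir2_Bop K lam hg.smooth hgc hx ht (hg0 v)).1
      (dir2_Bop K lam hf.smooth hc hx ht h0).1 measurableSet_Icc fun z hz => ?_
    have hf2 : ContDiffOn ℝ 2 f (posOrth n) := hf.smooth.of_le (by norm_num)
    rw [hgeq v z hz, ohlyIntegrand_eq K hf2 hx ht hz]
    exact le_add_of_nonneg_left (hc.fderiv_fderiv_nonneg (isOpen_posOrth n) hf2
      (K.add_mem_posOrth hx ht hz) _)

end
end

section
/- Let φ : (0,∞) × [0,1] → ℝ be measurable in z, C² in x with first and second x-derivatives bounded on compact subsets of (0,∞) uniformly in z, and satisfy φ(x,z)² ≤ D x² for some constant D (so in particular φ(x,z) → 0 as x → 0⁺). If ∫₀¹ ∂ₓₓφ(x,z) φ(x,z) dz ≥ 0 for every x > 0, then the function x ↦ x⁻² ∫₀¹ φ(x,z)² dz is nondecreasing on (0,∞). -/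
open MeasureTheory Set

noncomputable section

open Filter Topology

/-- The derivative in a parameter of a family of measurable functions is measurable. -/
lemma aestronglyMeasurable_of_hasDerivAt_param {α : Type*} [MeasurableSpace α] {μ : Measure α}
    {f : ℝ → α → ℝ} {f' : α → ℝ} {s : Set ℝ} {x : ℝ} (hs : s ∈ 𝓝 x)
    (hf : ∀ y ∈ s, AEStronglyMeasurable (f y) μ)
    (hderiv : ∀ᵐ z ∂μ, HasDerivAt (fun y => f y z) (f' z) x) :
    AEStronglyMeasurable f' μ := by
  obtain ⟨u, hu, hlim⟩ : ∃ u : ℕ → ℝ, (∀ n, x + u n ∈ s) ∧ Tendsto u atTop (𝓝[>] 0) := by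
    have hshift : ∀ᶠ t in 𝓝[>] (0 : ℝ), x + t ∈ s := by
      have : Tendsto (fun t : ℝ => x + t) (𝓝[>] 0) (𝓝 x) := by
        have h : Tendsto (fun t : ℝ => x + t) (𝓝 0) (𝓝 (x + 0)) :=
          (continuous_const.add continuous_id).tendsto 0
        rw [add_zero] at h
        exact h.mono_left nhdsWithin_le_nhds
      exact this hs
    obtain ⟨v, hv⟩ := exists_seq_tendsto (𝓝[>] (0 : ℝ))
    obtain ⟨N, hN⟩ := eventually_atTop.1 (hv.eventually hshift)
    exact ⟨fun n => v (n + N), fun n => hN _ (Nat.le_add_left _ _),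
      hv.comp (tendsto_add_atTop_nat N)⟩
  refine aestronglyMeasurable_of_tendsto_ae atTop
    (f := fun n z => (u n)⁻¹ • (f (x + u n) z - f x z)) (fun n => ?_) ?_
  · exact ((hf _ (hu n)).sub (hf _ (mem_of_mem_nhds hs))).const_smul (u n)⁻¹
  · filter_upwards [hderiv] with z hz
    exact hz.tendsto_slope_zero_right.comp hlim

lemma sq_integral_mul_le_integral_sq_mul_integral_sq {α : Type*} [MeasurableSpace α]
    {μ : Measure α} {f g : α → ℝ} (hf : Integrable (fun z => f z ^ 2) μ)
    (hg : Integrable (fun z => g z ^ 2) μ) (hfg : Integrable (fun z => f z * g z) μ) :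
    (∫ z, f z * g z ∂μ) ^ 2 ≤ (∫ z, f z ^ 2 ∂μ) * ∫ z, g z ^ 2 ∂μ := by
  have hquad : ∀ t : ℝ, 0 ≤ (∫ z, f z ^ 2 ∂μ) * (t * t) + (2 * ∫ z, f z * g z ∂μ) * t
      + ∫ z, g z ^ 2 ∂μ := fun t => by
    have hexp : ∫ z, (t * f z + g z) ^ 2 ∂μ = (∫ z, f z ^ 2 ∂μ) * (t * t)
        + (2 * ∫ z, f z * g z ∂μ) * t + ∫ z, g z ^ 2 ∂μ := by
      have : (fun z => (t * f z + g z) ^ 2)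
          = fun z => t * t * f z ^ 2 + 2 * t * (f z * g z) + g z ^ 2 := by
        funext z; ring
      have hf' : Integrable (fun z => t * t * f z ^ 2) μ := hf.const_mul _
      have hfg' : Integrable (fun z => 2 * t * (f z * g z)) μ := hfg.const_mul _
      have hsum : Integrable (fun z => t * t * f z ^ 2 + 2 * t * (f z * g z)) μ := hf'.add hfg'
      rw [this, integral_add hsum hg, integral_add hf' hfg', integral_const_mul, integral_const_mul]
      ring
    rw [← hexp]
    exact integral_nonneg fun z => sq_nonneg _
  have hdiscrim := discrim_le_zero hquad
  unfold discrim at hdiscrim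
  linarith

lemma convexOn_sqrt_of_sq_deriv_le {F F' F'' : ℝ → ℝ}
    (hF : ∀ x ∈ Ioi (0 : ℝ), HasDerivAt F (F' x) x)
    (hF' : ∀ x ∈ Ioi (0 : ℝ), HasDerivAt F' (F'' x) x)
    (hpos : ∀ x ∈ Ioi (0 : ℝ), 0 < F x)
    (hsq : ∀ x ∈ Ioi (0 : ℝ), F' x ^ 2 ≤ 2 * F x * F'' x) :
    ConvexOn ℝ (Ioi 0) (fun x => √(F x)) := by
  have hd : ∀ x ∈ Ioi (0 : ℝ), HasDerivAt (fun x => √(F x)) (F' x / (2 * √(F x))) x :=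
    fun x hx => (hF x hx).sqrt (hpos x hx).ne'
  refine convexOn_of_hasDerivWithinAt2_nonneg (convex_Ioi 0)
    (f' := fun x => F' x / (2 * √(F x)))
    (f'' := fun x => (F'' x * (2 * √(F x)) - F' x * (2 * (F' x / (2 * √(F x)))))
      / (2 * √(F x)) ^ 2)
    (fun x hx => (hd x hx).continuousAt.continuousWithinAt) ?_ ?_ ?_
  all_goals
    rw [interior_Ioi]
    intro x hx
    have hs : 0 < √(F x) := Real.sqrt_pos.2 (hpos x hx)
  · exact (hd x hx).hasDerivWithinAt
  · exact ((hF' x hx).div ((hd x hx).const_mul 2) (by positivity)).hasDerivWithinAt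
  · have hnum : F'' x * (2 * √(F x)) - F' x * (2 * (F' x / (2 * √(F x))))
        = (2 * F x * F'' x - F' x ^ 2) / √(F x) := by
      have := Real.sq_sqrt (hpos x hx).le
      field_simp
      rw [this]
    rw [hnum]
    exact div_nonneg (div_nonneg (sub_nonneg.2 (hsq x hx)) hs.le) (sq_nonneg _)

lemma monotoneOn_div_sq_of_sq_deriv_le {F F' F'' : ℝ → ℝ} {D : ℝ}
    (hF : ∀ x ∈ Ioi (0 : ℝ), HasDerivAt F (F' x) x)
    (hF' : ∀ x ∈ Ioi (0 : ℝ), HasDerivAt F' (F'' x) x)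
    (hnonneg : ∀ x ∈ Ioi (0 : ℝ), 0 ≤ F x)
    (hbound : ∀ x ∈ Ioi (0 : ℝ), F x ≤ D * x ^ 2)
    (hF'' : ∀ x ∈ Ioi (0 : ℝ), 0 ≤ F'' x)
    (hsq : ∀ x ∈ Ioi (0 : ℝ), F' x ^ 2 ≤ 2 * F x * F'' x) :
    MonotoneOn (fun x => F x / x ^ 2) (Ioi 0) := by
  intro a ha b hb hab
  rcases hab.eq_or_lt with rfl | hab
  · exact le_rfl
  have ha0 : 0 < a := ha
  have hb0 : 0 < b := hb
  have hsecant : ∀ s ∈ Ioo 0 a,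
      (b - s) * √(F a) ≤ (b - a) * (√(D + 1) * s) + (a - s) * √(F b + s ^ 2) := by
    intro s hs
    have hs0 : 0 < s ^ 2 := pow_pos hs.1 2
    have hconv : ConvexOn ℝ (Ioi 0) (fun x => √(F x + s ^ 2)) :=
      convexOn_sqrt_of_sq_deriv_le (fun x hx => (hF x hx).add_const _) hF'
        (fun x hx => add_pos_of_nonneg_of_pos (hnonneg x hx) hs0)
        (fun x hx => by nlinarith [hsq x hx, mul_nonneg hs0.le (hF'' x hx)])
    have hmono : √(F a) ≤ √(F a + s ^ 2) := Real.sqrt_le_sqrt (by linarith)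
    have hsmall : √(F s + s ^ 2) ≤ √(D + 1) * s := by
      rw [← Real.sqrt_sq hs.1.le, ← Real.sqrt_mul' _ hs0.le, Real.sqrt_sq hs.1.le]
      exact Real.sqrt_le_sqrt (by linarith [hbound s hs.1])
    calc (b - s) * √(F a) ≤ (b - s) * √(F a + s ^ 2) :=
          mul_le_mul_of_nonneg_left hmono (by linarith [hs.2])
      _ ≤ (b - a) * √(F s + s ^ 2) + (a - s) * √(F b + s ^ 2) :=
          hconv.secant_mono_aux1 hs.1 hb hs.2 hab
      _ ≤ _ := by gcongr
  have hlim : b * √(F a) ≤ a * √(F b) := by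
    have hl : Tendsto (fun s : ℝ => (b - s) * √(F a)) (𝓝[>] 0) (𝓝 ((b - 0) * √(F a))) :=
      ((by fun_prop : Continuous fun s : ℝ => (b - s) * √(F a)).tendsto 0).mono_left
        nhdsWithin_le_nhds
    have hr : Tendsto
        (fun s : ℝ => (b - a) * (√(D + 1) * s) + (a - s) * √(F b + s ^ 2)) (𝓝[>] 0)
        (𝓝 ((b - a) * (√(D + 1) * 0) + (a - 0) * √(F b + 0 ^ 2))) :=
      ((by fun_prop : Continuous fun s : ℝ =>
        (b - a) * (√(D + 1) * s) + (a - s) * √(F b + s ^ 2)).tendsto 0).mono_left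
        nhdsWithin_le_nhds
    have := le_of_tendsto_of_tendsto hl hr
      (eventually_of_mem (Ioo_mem_nhdsGT ha0) hsecant)
    simpa using this
  have hsquare := pow_le_pow_left₀ (by positivity) hlim 2
  rw [mul_pow, mul_pow, Real.sq_sqrt (hnonneg a ha), Real.sq_sqrt (hnonneg b hb)] at hsquare
  change F a / a ^ 2 ≤ F b / b ^ 2
  rw [div_le_div_iff₀ (by positivity) (by positivity)]
  linarith

/-- Monotonicity of the jump volatility (analytic core of Theorem 6.2): let
`φ : (0,∞) × [0,1] → ℝ` be measurable in `z`, `C²` in `x` with first and second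
`x`-derivatives bounded on compact subsets of `(0,∞)` uniformly in `z`, and satisfy
`φ(x,z)² ≤ D x²`. If `∫₀¹ ∂ₓₓφ(x,z) φ(x,z) dz ≥ 0` for every `x > 0`, then
`x ↦ x⁻² ∫₀¹ φ(x,z)² dz` is nondecreasing on `(0,∞)`. -/
theorem jumpVol_ratio_monotone
    (φ : ℝ → ℝ → ℝ) (D : ℝ)
    (hmeas : ∀ x ∈ Ioi (0:ℝ), Measurable (fun z => φ x z))
    (hsmooth : ∀ z ∈ Icc (0:ℝ) 1, ContDiffOn ℝ 2 (fun x => φ x z) (Ioi (0:ℝ)))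
    (hbd : ∀ Kc : Set ℝ, IsCompact Kc → Kc ⊆ Ioi (0:ℝ) →
      ∃ C : ℝ, ∀ z ∈ Icc (0:ℝ) 1, ∀ x ∈ Kc,
        |deriv (fun y => φ y z) x| ≤ C ∧ |deriv (deriv (fun y => φ y z)) x| ≤ C)
    (hbound : ∀ x ∈ Ioi (0:ℝ), ∀ z ∈ Icc (0:ℝ) 1, (φ x z) ^ 2 ≤ D * x ^ 2)
    (hineq : ∀ x ∈ Ioi (0:ℝ),
      0 ≤ ∫ z in Icc (0:ℝ) 1, deriv (deriv (fun y => φ y z)) x * φ x z) :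
    MonotoneOn (fun x => (∫ z in Icc (0:ℝ) 1, (φ x z) ^ 2) / x ^ 2) (Ioi (0:ℝ)) := by
  set μ : Measure ℝ := volume.restrict (Icc 0 1)
  have hfin : IsFiniteMeasure μ := by infer_instance
  set p : ℝ → ℝ → ℝ := fun x z => deriv (fun y => φ y z) x
  set q : ℝ → ℝ → ℝ := fun x z => deriv (deriv (fun y => φ y z)) x
  have hae : ∀ {P : ℝ → Prop}, (∀ z ∈ Icc (0 : ℝ) 1, P z) → ∀ᵐ z ∂μ, P z :=
    fun h => (ae_restrict_iff' measurableSet_Icc).2 (Eventually.of_forall h)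
  have hp : ∀ x ∈ Ioi (0 : ℝ), ∀ z ∈ Icc (0 : ℝ) 1, HasDerivAt (fun y => φ y z) (p x z) x :=
    fun x hx z hz => (((hsmooth z hz).differentiableOn (by norm_num)).differentiableAt
      (Ioi_mem_nhds hx)).hasDerivAt
  have hq : ∀ x ∈ Ioi (0 : ℝ), ∀ z ∈ Icc (0 : ℝ) 1, HasDerivAt (fun y => p y z) (q x z) x := by
    intro x hx z hz
    have hC1 : ContDiffOn ℝ 1 (deriv fun y => φ y z) (Ioi 0) :=
      (hsmooth z hz).deriv_of_isOpen isOpen_Ioi (by norm_num)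
    exact ((hC1.differentiableOn (by norm_num)).differentiableAt (Ioi_mem_nhds hx)).hasDerivAt
  have hφm : ∀ x ∈ Ioi (0 : ℝ), AEStronglyMeasurable (φ x) μ :=
    fun x hx => (hmeas x hx).aestronglyMeasurable
  have hpm : ∀ x ∈ Ioi (0 : ℝ), AEStronglyMeasurable (p x) μ := fun x hx =>
    aestronglyMeasurable_of_hasDerivAt_param (Ioi_mem_nhds hx) hφm (hae (hp x hx))
  have hqm : ∀ x ∈ Ioi (0 : ℝ), AEStronglyMeasurable (q x) μ := fun x hx =>
    aestronglyMeasurable_of_hasDerivAt_param (Ioi_mem_nhds hx) hpm (hae (hq x hx))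
  have hloc : ∀ x ∈ Ioi (0 : ℝ), ∃ C : ℝ, 0 ≤ C ∧ ∀ z ∈ Icc (0 : ℝ) 1,
      ∀ y ∈ Icc (x / 2) (2 * x), |φ y z| ≤ C ∧ |p y z| ≤ C ∧ |q y z| ≤ C := by
    intro x hx
    have hx0 : 0 < x := hx
    have hsub : Icc (x / 2) (2 * x) ⊆ Ioi 0 := fun y hy => lt_of_lt_of_le (half_pos hx0) hy.1
    obtain ⟨C, hC⟩ := hbd _ isCompact_Icc hsub
    refine ⟨max √(|D| * (2 * x) ^ 2) C, le_max_of_le_left (Real.sqrt_nonneg _),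
      fun z hz y hy => ⟨le_max_of_le_left (Real.abs_le_sqrt ?_),
        le_max_of_le_right (hC z hz y hy).1, le_max_of_le_right (hC z hz y hy).2⟩⟩
    have hy0 : 0 < y := hsub hy
    calc φ y z ^ 2 ≤ D * y ^ 2 := hbound y hy0 z hz
      _ ≤ |D| * (2 * x) ^ 2 := by
        gcongr
        · exact le_abs_self D
        · exact hy.2
  have hnhds : ∀ x ∈ Ioi (0 : ℝ), Icc (x / 2) (2 * x) ∈ 𝓝 x := fun x hx => by
    have hx0 : 0 < x := hx
    exact Icc_mem_nhds (by linarith) (by linarith)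
  have hint_mul : ∀ {f g : ℝ → ℝ} {C : ℝ}, AEStronglyMeasurable f μ → AEStronglyMeasurable g μ →
      0 ≤ C → (∀ z ∈ Icc (0 : ℝ) 1, |f z| ≤ C) → (∀ z ∈ Icc (0 : ℝ) 1, |g z| ≤ C) →
      Integrable (fun z => f z * g z) μ := by
    intro f g C hf hg hC hfC hgC
    refine Integrable.of_bound (hf.mul hg) (C * C) (hae fun z hz => ?_)
    rw [Real.norm_eq_abs, abs_mul]
    exact mul_le_mul (hfC z hz) (hgC z hz) (abs_nonneg _) hC
  have hints : ∀ x ∈ Ioi (0 : ℝ), Integrable (fun z => φ x z * φ x z) μ ∧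
      Integrable (fun z => φ x z * p x z) μ ∧ Integrable (fun z => p x z * p x z) μ ∧
      Integrable (fun z => q x z * φ x z) μ := by
    intro x hx
    obtain ⟨C, hC0, hC⟩ := hloc x hx
    have hmem : x ∈ Icc (x / 2) (2 * x) := mem_of_mem_nhds (hnhds x hx)
    have h1 : ∀ z ∈ Icc (0 : ℝ) 1, |φ x z| ≤ C := fun z hz => (hC z hz x hmem).1
    have h2 : ∀ z ∈ Icc (0 : ℝ) 1, |p x z| ≤ C := fun z hz => (hC z hz x hmem).2.1
    have h3 : ∀ z ∈ Icc (0 : ℝ) 1, |q x z| ≤ C := fun z hz => (hC z hz x hmem).2.2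
    exact ⟨hint_mul (hφm x hx) (hφm x hx) hC0 h1 h1, hint_mul (hφm x hx) (hpm x hx) hC0 h1 h2,
      hint_mul (hpm x hx) (hpm x hx) hC0 h2 h2, hint_mul (hqm x hx) (hφm x hx) hC0 h3 h1⟩
  have hsq_eq : ∀ f : ℝ → ℝ, (fun z => f z ^ 2) = fun z => f z * f z :=
    fun f => funext fun z => sq (f z)
  have hF : ∀ x ∈ Ioi (0 : ℝ), HasDerivAt (fun x => ∫ z, φ x z ^ 2 ∂μ)
      (∫ z, 2 * (φ x z * p x z) ∂μ) x := by
    intro x hx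
    have hx0 : 0 < x := hx
    obtain ⟨C, hC0, hC⟩ := hloc x hx
    refine (hasDerivAt_integral_of_dominated_loc_of_deriv_le (hnhds x hx)
      (F := fun x z => φ x z ^ 2) (F' := fun x z => 2 * (φ x z * p x z))
      (bound := fun _ => 2 * (C * C)) ?_ ?_ ?_ (hae ?_) (integrable_const _) (hae ?_)).2
    · filter_upwards [Ioi_mem_nhds hx0] with y hy using (hφm y hy).pow 2
    · exact hsq_eq (φ x) ▸ (hints x hx).1
    · exact ((hints x hx).2.1.const_mul 2).aestronglyMeasurable
    · intro z hz y hy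
      obtain ⟨h1, h2, -⟩ := hC z hz y hy
      rw [Real.norm_eq_abs, abs_mul, abs_mul, abs_two]
      gcongr
    · intro z hz y hy
      have hy0 : 0 < y := lt_of_lt_of_le (half_pos hx0) hy.1
      exact ((hp y hy0 z hz).pow 2).congr_deriv (by push_cast; ring)
  have hF' : ∀ x ∈ Ioi (0 : ℝ), HasDerivAt (fun x => ∫ z, 2 * (φ x z * p x z) ∂μ)
      (∫ z, 2 * (p x z * p x z + q x z * φ x z) ∂μ) x := by
    intro x hx
    have hx0 : 0 < x := hx
    obtain ⟨C, hC0, hC⟩ := hloc x hx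
    refine (hasDerivAt_integral_of_dominated_loc_of_deriv_le (hnhds x hx)
      (F := fun x z => 2 * (φ x z * p x z))
      (F' := fun x z => 2 * (p x z * p x z + q x z * φ x z))
      (bound := fun _ => 2 * (C * C + C * C)) ?_ ?_ ?_ (hae ?_) (integrable_const _) (hae ?_)).2
    · filter_upwards [Ioi_mem_nhds hx0] with y hy using
        ((hφm y hy).mul (hpm y hy)).const_mul 2
    · exact (hints x hx).2.1.const_mul 2
    · exact (((hints x hx).2.2.1.add (hints x hx).2.2.2).const_mul 2).aestronglyMeasurable
    · intro z hz y hy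
      obtain ⟨h1, h2, h3⟩ := hC z hz y hy
      rw [Real.norm_eq_abs, abs_mul, abs_two]
      refine mul_le_mul_of_nonneg_left ((abs_add_le _ _).trans ?_) zero_le_two
      rw [abs_mul, abs_mul]
      gcongr
    · intro z hz y hy
      have hy0 : 0 < y := lt_of_lt_of_le (half_pos hx0) hy.1
      exact (((hp y hy0 z hz).mul (hq y hy0 z hz)).const_mul 2).congr_deriv (by ring)
  have hF''_ge : ∀ x ∈ Ioi (0 : ℝ),
      2 * ∫ z, p x z ^ 2 ∂μ ≤ ∫ z, 2 * (p x z * p x z + q x z * φ x z) ∂μ := by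
    intro x hx
    obtain ⟨-, -, hpp, hqφ⟩ := hints x hx
    rw [integral_const_mul, integral_add hpp hqφ, hsq_eq (p x)]
    have : 0 ≤ ∫ z, q x z * φ x z ∂μ := hineq x hx
    linarith
  refine monotoneOn_div_sq_of_sq_deriv_le (D := D) hF hF'
    (fun x _ => integral_nonneg fun z => sq_nonneg _) (fun x hx => ?_)
    (fun x hx => le_trans ?_ (hF''_ge x hx)) (fun x hx => ?_)
  · calc ∫ z, φ x z ^ 2 ∂μ ≤ ∫ _, D * x ^ 2 ∂μ :=
          integral_mono_ae (hsq_eq (φ x) ▸ (hints x hx).1) (integrable_const _)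
            (hae (hbound x hx))
      _ = D * x ^ 2 := by simp [μ]
  · exact mul_nonneg zero_le_two (integral_nonneg fun z => sq_nonneg _)
  · obtain ⟨hφφ, hφp, hpp, -⟩ := hints x hx
    have hCS := sq_integral_mul_le_integral_sq_mul_integral_sq
      (hsq_eq (φ x) ▸ hφφ) (hsq_eq (p x) ▸ hpp) hφp
    have hφ0 : 0 ≤ ∫ z, φ x z ^ 2 ∂μ := integral_nonneg fun z => sq_nonneg _
    calc (∫ z, 2 * (φ x z * p x z) ∂μ) ^ 2 = 4 * (∫ z, φ x z * p x z ∂μ) ^ 2 := by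
          rw [integral_const_mul]; ring
      _ ≤ 2 * (∫ z, φ x z ^ 2 ∂μ) * (2 * ∫ z, p x z ^ 2 ∂μ) := by linarith
      _ ≤ _ := mul_le_mul_of_nonneg_left (hF''_ge x hx) (by positivity)

end
end

section
/- Let φ : (0,∞) × [0,1] → ℝ be measurable in z, C² in x with first and second x-derivatives bounded on compact subsets of (0,∞) uniformly in z, and satisfy φ(x,z)² ≤ D x² for some constant D (so φ(x,z) → 0 as x → 0⁺). Suppose ∫₀¹ ∂ₓₓφ(x,z) φ(x,z) dz ≥ 0 for every x > 0, and suppose that the function x ↦ x⁻² ∫₀¹ φ(x,z)² dz is constant on (0,∞). Then for almost every z ∈ [0,1] the function x ↦ φ(x,z) is linear: there exists a measurable γ : [0,1] → ℝ with φ(x,z) = γ(z) x for all x > 0, for almost every z. -/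
open MeasureTheory Set

noncomputable section

/-- Differentiation under the integral sign over `(0, ∞)`, for a family whose derivative is bounded
on compact intervals uniformly in the integration variable. The derivative is measurable as a limit
of difference quotients. -/
lemma hasDerivAt_integral_of_locally_bounded_deriv {α : Type*} [MeasurableSpace α] {μ : Measure α}
    [IsFiniteMeasure μ] {f f' : ℝ → α → ℝ}
    (hint : ∀ x, 0 < x → Integrable (f x) μ)
    (hderiv : ∀ᵐ z ∂μ, ∀ x, 0 < x → HasDerivAt (fun y => f y z) (f' x z) x)
    (hbd : ∀ a b : ℝ, 0 < a → ∃ C : ℝ, ∀ᵐ z ∂μ, ∀ x ∈ Icc a b, |f' x z| ≤ C)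
    {x : ℝ} (hx : 0 < x) :
    Integrable (f' x) μ ∧ HasDerivAt (fun y => ∫ z, f y z ∂μ) (∫ z, f' x z ∂μ) x := by
  have hmeas' : AEStronglyMeasurable (f' x) μ := by
    have hlim : Filter.Tendsto (fun n : ℕ => 1 / ((n : ℝ) + 1)) Filter.atTop
        (nhdsWithin (0 : ℝ) (Ioi 0)) :=
      tendsto_nhdsWithin_of_tendsto_nhds_of_eventually_within _
        tendsto_one_div_add_atTop_nhds_zero_nat
        (Filter.Eventually.of_forall fun n => mem_Ioi.2 Nat.one_div_pos_of_nat)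
    refine aestronglyMeasurable_of_tendsto_ae Filter.atTop
      (f := fun (n : ℕ) z => (1 / ((n : ℝ) + 1))⁻¹ • (f (x + 1 / ((n : ℝ) + 1)) z - f x z))
      (fun n => ?_) ?_
    · exact (((hint _ (by positivity)).sub (hint x hx)).smul (1 / ((n : ℝ) + 1))⁻¹).aestronglyMeasurable
    · filter_upwards [hderiv] with z hz
      exact (hz x hx).tendsto_slope_zero_right.comp hlim
  obtain ⟨C, hC⟩ := hbd (x / 2) (2 * x) (by linarith)
  have hnhds : Ioo (x / 2) (2 * x) ∈ nhds x := Ioo_mem_nhds (by linarith) (by linarith)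
  have hx_bd : ∀ᵐ z ∂μ, |f' x z| ≤ C := by
    filter_upwards [hC] with z hz using hz x ⟨by linarith, by linarith⟩
  refine ⟨.of_bound hmeas' C hx_bd,
    (hasDerivAt_integral_of_dominated_loc_of_deriv_le (bound := fun _ => C) hnhds
      ?_ (hint x hx) hmeas' ?_ (integrable_const C) ?_).2⟩
  · filter_upwards [eventually_gt_nhds hx] with y hy using (hint y hy).aestronglyMeasurable
  · filter_upwards [hC] with z hz y hy using hz y (Ioo_subset_Icc_self hy)
  · filter_upwards [hderiv] with z hz y hy
    exact hz y (by linarith [hy.1])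

/-- If `∫ f(x, ·)² = c x²` and `∫ ∂ₓₓf(x, ·) f(x, ·) ≥ 0` then `∂ₓf(x, ·) = f(x, ·) / x` almost
everywhere: differentiating twice gives `∫ f ∂ₓf = c x` and `∫ (∂ₓf)² ≤ c`, so that
`∫ (∂ₓf - f / x)² ≤ 0`. -/
lemma ae_deriv_eq_div_of_integral_sq_eq {α : Type*} [MeasurableSpace α] {μ : Measure α}
    [IsFiniteMeasure μ] {f f' f'' : ℝ → α → ℝ} {c : ℝ}
    (hmeas : ∀ x, 0 < x → AEStronglyMeasurable (f x) μ)
    (hf : ∀ᵐ z ∂μ, ∀ x, 0 < x → HasDerivAt (fun y => f y z) (f' x z) x)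
    (hf' : ∀ᵐ z ∂μ, ∀ x, 0 < x → HasDerivAt (fun y => f' y z) (f'' x z) x)
    (hbd : ∀ a b : ℝ, 0 < a → ∃ C : ℝ, ∀ᵐ z ∂μ, ∀ x ∈ Icc a b,
      |f x z| ≤ C ∧ |f' x z| ≤ C ∧ |f'' x z| ≤ C)
    (hineq : ∀ x, 0 < x → 0 ≤ ∫ z, f'' x z * f x z ∂μ)
    (hconst : ∀ x, 0 < x → ∫ z, f x z ^ 2 ∂μ = c * x ^ 2) {x : ℝ} (hx : 0 < x) :
    ∀ᵐ z ∂μ, f' x z = f x z / x := by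
  have hfint : ∀ x, 0 < x → Integrable (f x) μ := fun x hx => by
    obtain ⟨C, hC⟩ := hbd x x hx
    refine .of_bound (hmeas x hx) C ?_
    filter_upwards [hC] with z hz using (hz x ⟨le_rfl, le_rfl⟩).1
  have hf'meas : ∀ x, 0 < x → AEStronglyMeasurable (f' x) μ := fun x hx =>
    (hasDerivAt_integral_of_locally_bounded_deriv hfint hf (fun a b ha => by
      obtain ⟨C, hC⟩ := hbd a b ha
      exact ⟨C, by filter_upwards [hC] with z hz y hy using (hz y hy).2.1⟩)
      hx).1.aestronglyMeasurable
  have hprod : ∀ {p q C : ℝ}, |p| ≤ C → |q| ≤ C → |p * q| ≤ C * C := fun {p q C} hp hq => by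
    rw [abs_mul]
    exact mul_le_mul hp hq (abs_nonneg _) ((abs_nonneg _).trans hp)
  have hffint : ∀ x, 0 < x → Integrable (fun z => f x z * f x z) μ := fun x hx => by
    obtain ⟨C, hC⟩ := hbd x x hx
    refine .of_bound ((hmeas x hx).mul (hmeas x hx)) (C * C) ?_
    filter_upwards [hC] with z hz
    have := hz x ⟨le_rfl, le_rfl⟩
    exact hprod this.1 this.1
  have hf'f'int : Integrable (fun z => f' x z * f' x z) μ := by
    obtain ⟨C, hC⟩ := hbd x x hx
    refine .of_bound ((hf'meas x hx).mul (hf'meas x hx)) (C * C) ?_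
    filter_upwards [hC] with z hz
    have := hz x ⟨le_rfl, le_rfl⟩
    exact hprod this.2.1 this.2.1
  have hff'int : ∀ x, 0 < x → Integrable (fun z => f x z * f' x z) μ := fun x hx => by
    obtain ⟨C, hC⟩ := hbd x x hx
    refine .of_bound ((hmeas x hx).mul (hf'meas x hx)) (C * C) ?_
    filter_upwards [hC] with z hz
    have := hz x ⟨le_rfl, le_rfl⟩
    exact hprod this.1 this.2.1
  have hfirst : ∀ x, 0 < x → ∫ z, f x z * f' x z ∂μ = c * x := fun x hx => by
    have hd := (hasDerivAt_integral_of_locally_bounded_deriv hffint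
      (f' := fun x z => f' x z * f x z + f x z * f' x z)
      (by filter_upwards [hf] with z hz y hy using (hz y hy).mul (hz y hy))
      (fun a b ha => by
        obtain ⟨C, hC⟩ := hbd a b ha
        refine ⟨C * C + C * C, ?_⟩
        filter_upwards [hC] with z hz y hy
        obtain ⟨h0, h1, -⟩ := hz y hy
        exact (abs_add_le _ _).trans (add_le_add (hprod h1 h0) (hprod h0 h1))) hx).2
    have hd' : HasDerivAt (fun y => ∫ z, f y z * f y z ∂μ) (c * (2 * x)) x := by
      have : HasDerivAt (fun y : ℝ => c * y ^ 2) (c * (2 * x)) x := by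
        simpa using (hasDerivAt_pow 2 x).const_mul c
      refine this.congr_of_eventuallyEq ?_
      filter_upwards [eventually_gt_nhds hx] with y hy
      simpa only [sq] using hconst y hy
    have heq := hd.unique hd'
    have : ∫ z, (f' x z * f x z + f x z * f' x z) ∂μ = 2 * ∫ z, f x z * f' x z ∂μ := by
      rw [← integral_const_mul]
      exact integral_congr_ae (.of_forall fun z => by ring)
    linarith
  have hsecond : Integrable (fun z => f' x z * f' x z + f x z * f'' x z) μ ∧
      ∫ z, (f' x z * f' x z + f x z * f'' x z) ∂μ = c := by
    obtain ⟨hi, hd⟩ := hasDerivAt_integral_of_locally_bounded_deriv hff'int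
      (f' := fun x z => f' x z * f' x z + f x z * f'' x z)
      (by filter_upwards [hf, hf'] with z hz hz' y hy using (hz y hy).mul (hz' y hy))
      (fun a b ha => by
        obtain ⟨C, hC⟩ := hbd a b ha
        refine ⟨C * C + C * C, ?_⟩
        filter_upwards [hC] with z hz y hy
        obtain ⟨h0, h1, h2⟩ := hz y hy
        exact (abs_add_le _ _).trans (add_le_add (hprod h1 h1) (hprod h0 h2))) hx
    refine ⟨hi, hd.unique ?_⟩
    have : HasDerivAt (fun y : ℝ => c * y) c x := by
      simpa using (hasDerivAt_id x).const_mul c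
    refine this.congr_of_eventuallyEq ?_
    filter_upwards [eventually_gt_nhds hx] with y hy using hfirst y hy
  have hle : ∫ z, f' x z * f' x z ∂μ ≤ c := by
    have hff'' : Integrable (fun z => f'' x z * f x z) μ := by
      refine (hsecond.1.sub hf'f'int).congr (.of_forall fun z => ?_)
      simp only [Pi.sub_apply]
      ring
    have : ∫ z, (f' x z * f' x z + f x z * f'' x z) ∂μ
        = ∫ z, f' x z * f' x z ∂μ + ∫ z, f'' x z * f x z ∂μ := by
      rw [← integral_add hf'f'int hff'']
      exact integral_congr_ae (.of_forall fun z => by ring)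
    linarith [hineq x hx, hsecond.2]
  have hdiff : Integrable (fun z => f' x z * f' x z - 2 / x * (f x z * f' x z)) μ :=
    hf'f'int.sub ((hff'int x hx).const_mul _)
  have hff := (hffint x hx).const_mul ((x ^ 2)⁻¹)
  have hexpand : ∀ z, (f' x z - f x z / x) ^ 2 =
      f' x z * f' x z - 2 / x * (f x z * f' x z) + (x ^ 2)⁻¹ * (f x z * f x z) := fun z => by
    field_simp
    ring
  have hsqint : Integrable (fun z => (f' x z - f x z / x) ^ 2) μ :=
    (hdiff.add hff).congr (.of_forall fun z => (hexpand z).symm)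
  have hzero : ∫ z, (f' x z - f x z / x) ^ 2 ∂μ = 0 := by
    refine le_antisymm ?_ (integral_nonneg fun z => sq_nonneg _)
    have hffx : ∫ z, f x z * f x z ∂μ = c * x ^ 2 := by simpa only [sq] using hconst x hx
    simp only [hexpand]
    rw [integral_add hdiff hff, integral_sub hf'f'int ((hff'int x hx).const_mul _),
      integral_const_mul, integral_const_mul, hfirst x hx, hffx]
    have h1 : 2 / x * (c * x) = 2 * c := by field_simp
    have h2 : (x ^ 2)⁻¹ * (c * x ^ 2) = c := by field_simp
    linarith
  filter_upwards [(integral_eq_zero_iff_of_nonneg (fun z => sq_nonneg _) hsqint).1 hzero] with z hz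
  exact sub_eq_zero.1 (pow_eq_zero_iff two_ne_zero |>.1 hz)

/-- A solution of `g' = g / x` on `(0, ∞)` is linear. -/
lemma eq_mul_of_hasDerivAt_div_self {g : ℝ → ℝ}
    (hg : ∀ x ∈ Ioi (0 : ℝ), HasDerivAt g (g x / x) x) {x : ℝ} (hx : x ∈ Ioi (0 : ℝ)) :
    g x = g 1 * x := by
  have hd : ∀ y ∈ Ioi (0 : ℝ), HasDerivAt (fun y => g y / y) 0 y := fun y hy => by
    have hy0 : y ≠ 0 := ne_of_gt hy
    exact ((hg y hy).div (hasDerivAt_id y) hy0).congr_deriv (by simp [hy0])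
  have := isOpen_Ioi.is_const_of_deriv_eq_zero isPreconnected_Ioi
    (fun y hy => (hd y hy).differentiableAt.differentiableWithinAt)
    (fun y hy => (hd y hy).deriv) hx (mem_Ioi.2 one_pos)
  have hx0 : x ≠ 0 := ne_of_gt hx
  simp only [div_one] at this
  rw [← this]
  field_simp

/-- Jensen-equality step: let `φ : (0,∞) × [0,1] → ℝ` be measurable in `z`, `C²` in `x`
with first and second `x`-derivatives bounded on compact subsets of `(0,∞)` uniformly in
`z`, and satisfy `φ(x,z)² ≤ D x²`. Suppose `∫₀¹ ∂ₓₓφ(x,z) φ(x,z) dz ≥ 0` for every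
`x > 0`, and that `x ↦ x⁻² ∫₀¹ φ(x,z)² dz` is constant on `(0,∞)`. Then for almost every
`z ∈ [0,1]` the map `x ↦ φ(x,z)` is linear: there is a measurable `γ : [0,1] → ℝ` with
`φ(x,z) = γ(z) x` for all `x > 0`, for a.e. `z`. -/
theorem jump_linear_of_constant_vol
    (φ : ℝ → ℝ → ℝ) (D : ℝ)
    (hmeas : ∀ x ∈ Ioi (0:ℝ), Measurable (fun z => φ x z))
    (hsmooth : ∀ z ∈ Icc (0:ℝ) 1, ContDiffOn ℝ 2 (fun x => φ x z) (Ioi (0:ℝ)))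
    (hbd : ∀ Kc : Set ℝ, IsCompact Kc → Kc ⊆ Ioi (0:ℝ) →
      ∃ C : ℝ, ∀ z ∈ Icc (0:ℝ) 1, ∀ x ∈ Kc,
        |deriv (fun y => φ y z) x| ≤ C ∧ |deriv (deriv (fun y => φ y z)) x| ≤ C)
    (hbound : ∀ x ∈ Ioi (0:ℝ), ∀ z ∈ Icc (0:ℝ) 1, (φ x z) ^ 2 ≤ D * x ^ 2)
    (hineq : ∀ x ∈ Ioi (0:ℝ),
      0 ≤ ∫ z in Icc (0:ℝ) 1, deriv (deriv (fun y => φ y z)) x * φ x z)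
    (hconst : ∃ c : ℝ, ∀ x ∈ Ioi (0:ℝ),
      (∫ z in Icc (0:ℝ) 1, (φ x z) ^ 2) / x ^ 2 = c) :
    ∃ γ : ℝ → ℝ, Measurable γ ∧
      ∀ᵐ z ∂(volume.restrict (Icc (0:ℝ) 1)), ∀ x ∈ Ioi (0:ℝ), φ x z = γ z * x := by
  obtain ⟨c, hc⟩ := hconst
  refine ⟨fun z => φ 1 z, hmeas 1 (mem_Ioi.2 one_pos), ?_⟩
  have hmem : ∀ᵐ z ∂(volume.restrict (Icc (0:ℝ) 1)), z ∈ Icc (0:ℝ) 1 :=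
    ae_restrict_mem measurableSet_Icc
  have hsmooth' : ∀ z ∈ Icc (0:ℝ) 1, ContDiffOn ℝ 1 (deriv fun y => φ y z) (Ioi (0:ℝ)) :=
    fun z hz => (hsmooth z hz).deriv_of_isOpen isOpen_Ioi (by norm_num)
  have hd : ∀ z ∈ Icc (0:ℝ) 1, ∀ x, 0 < x →
      HasDerivAt (fun y => φ y z) (deriv (fun y => φ y z) x) x := fun z hz x hx =>
    (((hsmooth z hz).differentiableOn (by norm_num)).differentiableAt
      (Ioi_mem_nhds hx)).hasDerivAt
  have hd' : ∀ z ∈ Icc (0:ℝ) 1, ∀ x, 0 < x →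
      HasDerivAt (deriv fun y => φ y z) (deriv (deriv fun y => φ y z) x) x := fun z hz x hx =>
    (((hsmooth' z hz).differentiableOn (by norm_num)).differentiableAt
      (Ioi_mem_nhds hx)).hasDerivAt
  have hae : ∀ x, 0 < x → ∀ᵐ z ∂(volume.restrict (Icc (0:ℝ) 1)),
      deriv (fun y => φ y z) x = φ x z / x := fun x hx => by
    refine ae_deriv_eq_div_of_integral_sq_eq (c := c)
      (f' := fun x z => deriv (fun y => φ y z) x)
      (f'' := fun x z => deriv (deriv fun y => φ y z) x)
      (fun x hx => (hmeas x hx).aestronglyMeasurable) ?_ ?_ (fun a b ha => ?_) hineq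
      (fun x hx => ?_) hx
    · filter_upwards [hmem] with z hz using hd z hz
    · filter_upwards [hmem] with z hz using hd' z hz
    · obtain ⟨C, hC⟩ := hbd (Icc a b) isCompact_Icc fun y hy => ha.trans_le hy.1
      refine ⟨max C √(|D| * b ^ 2), ?_⟩
      filter_upwards [hmem] with z hz y hy
      have hy0 : 0 < y := ha.trans_le hy.1
      refine ⟨le_max_of_le_right (Real.abs_le_sqrt ?_), le_max_of_le_left (hC z hz y hy).1,
        le_max_of_le_left (hC z hz y hy).2⟩
      calc φ y z ^ 2 ≤ D * y ^ 2 := hbound y hy0 z hz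
        _ ≤ |D| * y ^ 2 := by gcongr; exact le_abs_self D
        _ ≤ |D| * b ^ 2 := by gcongr; exact hy.2
    · exact (div_eq_iff (by positivity)).1 (hc x hx)
  have hrat : ∀ᵐ z ∂(volume.restrict (Icc (0:ℝ) 1)), ∀ q : ℚ, (0:ℝ) < q →
      deriv (fun y => φ y z) q = φ q z / q :=
    ae_all_iff.2 fun q => Filter.eventually_imp_distrib_left.2 (hae q)
  filter_upwards [hmem, hrat] with z hz hq x hx
  have heq : EqOn (deriv fun y => φ y z) (fun y => φ y z / y) (Ioi 0) := by
    refine EqOn.of_subset_closure (s := Ioi 0 ∩ range ((↑) : ℚ → ℝ)) ?_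
      (hsmooth' z hz).continuousOn
      ((hsmooth z hz).continuousOn.div continuousOn_id fun y hy => ne_of_gt hy)
      inter_subset_left (Rat.denseRange_cast.open_subset_closure_inter isOpen_Ioi)
    rintro _ ⟨hpos, q, rfl⟩
    exact hq q hpos
  refine eq_mul_of_hasDerivAt_div_self (g := fun y => φ y z) (fun y hy => ?_) hx
  have hy' : deriv (fun y => φ y z) y = φ y z / y := heq hy
  rw [← hy']
  exact hd z hz y hy

end
end
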